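/- arXiv:2210.03805 — 3 statements merged into one kernel-verified Lean document; each statement's English description precedes it below -/
import Mathlib

section
/- Subspaces avoidance. Assume that the compact set K of Borel probability measures on SL(d,ℝ) satisfies the log-moment condition and the measures condition, and assume moreover that for some m with 1 ≤ m ≤ d−1 and for every j = 1, …, m there are no measure μ ∈ K and finite unions U, U' of j-dimensional linear subspaces of ℝ^d such that A(U) = U' for μ-a.e. A ∈ SL(d,ℝ). Then for every ε > 0 there is a number k_m(ε) such that for every k ≥ k_m(ε), every x₀ ∈ ℝP^{d−1}, every L ∈ Gr(m,d), and every μ₁, …, μ_k ∈ K, the probability that (f_k ∘ ⋯ ∘ f₁)(x₀) ∈ [L] is less than ε, where f₁, …, f_k are the projective maps induced by independent random matrices A₁, …, A_k distributed according to μ₁, …, μ_k respectively. -/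
open MeasureTheory Matrix Filter
open scoped ENNReal

noncomputable section

/-- `SL(d, ℝ)`. -/
abbrev SL (d : ℕ) := Matrix.SpecialLinearGroup (Fin d) ℝ

instance (d : ℕ) : TopologicalSpace (SL d) :=
  inferInstanceAs (TopologicalSpace { A : Matrix (Fin d) (Fin d) ℝ // A.det = 1 })

instance (d : ℕ) : MeasurableSpace (SL d) := borel _
instance (d : ℕ) : BorelSpace (SL d) := ⟨rfl⟩

/-- Operator norm of a real `d × d` matrix, acting on Euclidean space. -/
def opNorm {d : ℕ} (A : Matrix (Fin d) (Fin d) ℝ) : ℝ :=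
  ‖Matrix.toEuclideanCLM (𝕜 := ℝ) A‖

/-- The norm `‖A‖` of `A ∈ SL(d, ℝ)`. -/
def slNorm {d : ℕ} (A : SL d) : ℝ := opNorm (A : Matrix (Fin d) (Fin d) ℝ)

/-- `A` applied to a vector `v ∈ ℝ^d` (with the Euclidean norm). -/
def slVec {d : ℕ} (A : SL d) (v : EuclideanSpace ℝ (Fin d)) : EuclideanSpace ℝ (Fin d) :=
  Matrix.toEuclideanCLM (𝕜 := ℝ) (A : Matrix (Fin d) (Fin d) ℝ) v

/-- The random (reversed) product `Tₙ = Aₙ ⋯ A₂ A₁`, where `Aᵢ = ω (i-1)`. -/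
def T {d : ℕ} (ω : ℕ → SL d) : ℕ → SL d
  | 0 => 1
  | n + 1 => ω n * T ω n

/-- The projective space `ℝP^{d-1}`. -/
abbrev Proj (d : ℕ) := Projectivization ℝ (Fin d → ℝ)

instance (d : ℕ) : TopologicalSpace (Proj d) :=
  inferInstanceAs (TopologicalSpace (Quotient (projectivizationSetoid ℝ (Fin d → ℝ))))

instance (d : ℕ) : MeasurableSpace (Proj d) := borel _
instance (d : ℕ) : BorelSpace (Proj d) := ⟨rfl⟩

/-- The linear map induced by `A ∈ SL(d, ℝ)` is injective. -/
theorem toLin'_injective {d : ℕ} (A : SL d) :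
    Function.Injective (Matrix.toLin' (A : Matrix (Fin d) (Fin d) ℝ)) := by
  apply Function.LeftInverse.injective
    (g := Matrix.toLin' ((A⁻¹ : SL d) : Matrix (Fin d) (Fin d) ℝ))
  intro x
  rw [← Matrix.toLin'_mul_apply, ← Matrix.SpecialLinearGroup.coe_mul, inv_mul_cancel,
    Matrix.SpecialLinearGroup.coe_one, Matrix.toLin'_one, LinearMap.id_apply]

/-- The projective map `f_A : ℝP^{d-1} → ℝP^{d-1}` induced by `A ∈ SL(d, ℝ)`. -/
def projMap {d : ℕ} (A : SL d) : Proj d → Proj d :=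
  Projectivization.map (Matrix.toLin' (A : Matrix (Fin d) (Fin d) ℝ)) (toLin'_injective A)

/-- The subset `[L] ⊆ ℝP^{d-1}` corresponding to a linear subspace `L ≤ ℝ^d`. -/
def projSet {d : ℕ} (L : Submodule ℝ (Fin d → ℝ)) : Set (Proj d) :=
  {x : Proj d | x.submodule ≤ L}

/-- Finite moment condition for a single measure, with exponent `γ` and bound `C`. -/
def FiniteMomentCondition {d : ℕ} (γ C : ℝ) (μ : ProbabilityMeasure (SL d)) : Prop :=
  ∫⁻ A, ENNReal.ofReal (slNorm A ^ γ) ∂(μ : Measure (SL d)) < ENNReal.ofReal C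

/-- Log-moment condition: `∫ log ‖A‖ dμ(A) < ∞`. -/
def LogMomentCondition {d : ℕ} (μ : ProbabilityMeasure (SL d)) : Prop :=
  ∫⁻ A, ENNReal.ofReal (Real.log (slNorm A)) ∂(μ : Measure (SL d)) < ⊤

/-- Measures condition: there are no Borel probability measures `ν₁`, `ν₂` on `ℝP^{d-1}`
with `(f_A)_* ν₁ = ν₂` for `μ`-a.e. `A`. -/
def MeasuresCondition {d : ℕ} (μ : ProbabilityMeasure (SL d)) : Prop :=
  ¬ ∃ (ν₁ ν₂ : ProbabilityMeasure (Proj d)),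
      ∀ᵐ A ∂(μ : Measure (SL d)),
        (ν₁ : Measure (Proj d)).map (projMap A) = (ν₂ : Measure (Proj d))

/-- `U ⊆ ℝ^d` is a (nonempty) finite union of proper nonzero linear subspaces. -/
def IsFiniteUnionOfProperSubspaces {d : ℕ} (U : Set (Fin d → ℝ)) : Prop :=
  ∃ S : Set (Submodule ℝ (Fin d → ℝ)), S.Finite ∧ S.Nonempty ∧
    (∀ W ∈ S, W ≠ ⊥ ∧ W ≠ ⊤) ∧ U = ⋃ W ∈ S, (W : Set (Fin d → ℝ))

/-- `U ⊆ ℝ^d` is a (nonempty) finite union of `j`-dimensional linear subspaces. -/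
def IsFiniteUnionOfDimSubspaces {d : ℕ} (j : ℕ) (U : Set (Fin d → ℝ)) : Prop :=
  ∃ S : Set (Submodule ℝ (Fin d → ℝ)), S.Finite ∧ S.Nonempty ∧
    (∀ W ∈ S, Module.finrank ℝ W = j) ∧ U = ⋃ W ∈ S, (W : Set (Fin d → ℝ))

/-- Spaces condition: there are no two finite unions `U`, `U'` of proper nonzero subspaces
of `ℝ^d` such that `A(U) = U'` for `μ`-a.e. `A`. -/
def SpacesCondition {d : ℕ} (μ : ProbabilityMeasure (SL d)) : Prop :=
  ¬ ∃ U U' : Set (Fin d → ℝ), IsFiniteUnionOfProperSubspaces U ∧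
      IsFiniteUnionOfProperSubspaces U' ∧
      ∀ᵐ (A : SL d) ∂(μ : Measure (SL d)),
        (fun v => Matrix.toLin' (A : Matrix (Fin d) (Fin d) ℝ) v) '' U = U'

/-- `ℙ` is the product measure `μ₁ × μ₂ × ⋯` on sequences, characterized by its
finite-dimensional marginals. -/
def IsProductMeasure {d : ℕ} (μ : ℕ → ProbabilityMeasure (SL d))
    (ℙ : Measure (ℕ → SL d)) : Prop :=
  IsProbabilityMeasure ℙ ∧
    ∀ n : ℕ, ℙ.map (fun ω (i : Fin n) => ω i) =
      Measure.pi (fun i : Fin n => ((μ i : Measure (SL d))))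

/-- `Lₙ = E log ‖Tₙ‖`. -/
def L {d : ℕ} (ℙ : Measure (ℕ → SL d)) (n : ℕ) : ℝ :=
  ∫ ω, Real.log (slNorm (T ω n)) ∂ℙ

/-- `L_{[n,m]} = E log ‖A_m ⋯ A_{n+1}‖`. -/
def Lseg {d : ℕ} (ℙ : Measure (ℕ → SL d)) (n m : ℕ) : ℝ :=
  ∫ ω, Real.log (slNorm (T ω m * (T ω n)⁻¹)) ∂ℙ

section WalkLaw

variable {d : ℕ}

instance : SecondCountableTopology (SL d) :=
  inferInstanceAs (SecondCountableTopology {A : Fin d → Fin d → ℝ // Matrix.det A = 1})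

instance : TopologicalSpace.PseudoMetrizableSpace (SL d) :=
  inferInstanceAs (TopologicalSpace.PseudoMetrizableSpace {A : Fin d → Fin d → ℝ // Matrix.det A = 1})

theorem continuous_coe_SL : Continuous (fun A : SL d => (A : Matrix (Fin d) (Fin d) ℝ)) :=
  continuous_subtype_val

theorem continuous_SL_mulVec :
    Continuous fun p : SL d × (Fin d → ℝ) => (p.1 : Matrix (Fin d) (Fin d) ℝ) *ᵥ p.2 :=
  (continuous_coe_SL.comp continuous_fst).matrix_mulVec continuous_snd

theorem measurable_SL_mulVec :
    Measurable fun p : SL d × (Fin d → ℝ) => (p.1 : Matrix (Fin d) (Fin d) ℝ) *ᵥ p.2 :=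
  continuous_SL_mulVec.measurable

/-- The law of `Aₙ ⋯ A₁ v`, where `A₁, A₂, …` are independent with laws `μ 0, μ 1, …`. -/
def walkLaw (μ : ℕ → ProbabilityMeasure (SL d)) (v : Fin d → ℝ) : ℕ → Measure (Fin d → ℝ)
  | 0 => Measure.dirac v
  | n + 1 => ((μ n : Measure (SL d)).prod (walkLaw μ v n)).map
      (fun p => (p.1 : Matrix (Fin d) (Fin d) ℝ) *ᵥ p.2)

instance (μ : ℕ → ProbabilityMeasure (SL d)) (v : Fin d → ℝ) (n : ℕ) :
    IsProbabilityMeasure (walkLaw μ v n) := by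
  induction n with
  | zero => unfold walkLaw; infer_instance
  | succ n ih =>
    unfold walkLaw
    exact Measure.isProbabilityMeasure_map measurable_SL_mulVec.aemeasurable

theorem walkLaw_succ_apply (μ : ℕ → ProbabilityMeasure (SL d)) (v : Fin d → ℝ) (n : ℕ)
    {s : Set (Fin d → ℝ)} (hs : MeasurableSet s) :
    walkLaw μ v (n + 1) s =
      ∫⁻ A, walkLaw μ v n {x | (A : Matrix (Fin d) (Fin d) ℝ) *ᵥ x ∈ s} ∂(μ n : Measure (SL d)) := by
  rw [walkLaw, Measure.map_apply measurable_SL_mulVec hs,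
    Measure.prod_apply (measurable_SL_mulVec hs)]
  rfl

theorem measurable_walkLaw_preimage (μ : ℕ → ProbabilityMeasure (SL d)) (v : Fin d → ℝ) (n : ℕ)
    {s : Set (Fin d → ℝ)} (hs : MeasurableSet s) :
    Measurable fun A : SL d => walkLaw μ v n {x | (A : Matrix (Fin d) (Fin d) ℝ) *ᵥ x ∈ s} :=
  measurable_measure_prodMk_left (measurable_SL_mulVec hs)

theorem walkLaw_singleton_zero (μ : ℕ → ProbabilityMeasure (SL d)) {v : Fin d → ℝ} (hv : v ≠ 0)
    (n : ℕ) : walkLaw μ v n {0} = 0 := by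
  induction n with
  | zero => simp [walkLaw, hv]
  | succ n ih =>
    rw [walkLaw_succ_apply μ v n (measurableSet_singleton 0)]
    have h (A : SL d) : {x | (A : Matrix (Fin d) (Fin d) ℝ) *ᵥ x ∈ ({0} : Set (Fin d → ℝ))}
        = {0} := by
      ext x
      simpa using (toLin'_injective A).eq_iff' (map_zero _)
    simp only [h, ih, lintegral_zero]

/-- The product `Aₙ ⋯ A₁` applied to `v`, as a function of the first `n` matrices. -/
def orbit (v : Fin d → ℝ) : (n : ℕ) → (Fin n → SL d) → Fin d → ℝ
  | 0, _ => v
  | n + 1, A => (A (Fin.last n) : Matrix (Fin d) (Fin d) ℝ) *ᵥ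
      orbit v n (fun i => A i.castSucc)

theorem measurable_orbit (v : Fin d → ℝ) (n : ℕ) : Measurable (orbit v n) := by
  induction n with
  | zero => exact measurable_const
  | succ n ih =>
    have h : Measurable fun (A : Fin (n + 1) → SL d) (i : Fin n) => A i.castSucc :=
      measurable_pi_lambda _ fun i => measurable_pi_apply _
    exact measurable_SL_mulVec.comp ((measurable_pi_apply (Fin.last n)).prodMk (ih.comp h))

theorem orbit_eq_T_mulVec (v : Fin d → ℝ) (ω : ℕ → SL d) (n : ℕ) :
    orbit v n (fun i => ω i) = (T ω n : Matrix (Fin d) (Fin d) ℝ) *ᵥ v := by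
  induction n with
  | zero => simp [orbit, T]
  | succ n ih => simp [orbit, T, ih, Matrix.mulVec_mulVec]

theorem map_orbit_pi (μ : ℕ → ProbabilityMeasure (SL d)) (v : Fin d → ℝ) (n : ℕ) :
    (Measure.pi fun i : Fin n => (μ i : Measure (SL d))).map (orbit v n) = walkLaw μ v n := by
  induction n with
  | zero =>
    have : orbit v 0 = fun _ => v := rfl
    rw [this, Measure.map_const]
    simp [walkLaw]
  | succ n ih =>
    have h := measurePreserving_piFinSuccAbove
      (fun i : Fin (n + 1) => (μ i : Measure (SL d))) (Fin.last n)
    have h2 : orbit v (n + 1) =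
        (fun p : SL d × (Fin d → ℝ) => (p.1 : Matrix (Fin d) (Fin d) ℝ) *ᵥ p.2) ∘
          Prod.map id (orbit v n) ∘
            MeasurableEquiv.piFinSuccAbove (fun _ : Fin (n + 1) => SL d) (Fin.last n) := by
      ext A : 1
      simp [orbit, MeasurableEquiv.piFinSuccAbove, Fin.init_def]
    rw [h2, ← Measure.map_map measurable_SL_mulVec
      ((measurable_id.prodMap (measurable_orbit v n)).comp (MeasurableEquiv.measurable _)),
      ← Measure.map_map (measurable_id.prodMap (measurable_orbit v n))
        (MeasurableEquiv.measurable _), h.map_eq, walkLaw, ← ih,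
        ← Measure.map_prod_map _ _ measurable_id (measurable_orbit v n)]
    simp

theorem IsProductMeasure.apply_eq_walkLaw {μ : ℕ → ProbabilityMeasure (SL d)}
    {ℙ : Measure (ℕ → SL d)} (h : IsProductMeasure μ ℙ) (v : Fin d → ℝ) (n : ℕ)
    {s : Set (Fin d → ℝ)} (hs : MeasurableSet s) :
    ℙ {ω | (T ω n : Matrix (Fin d) (Fin d) ℝ) *ᵥ v ∈ s} = walkLaw μ v n s := by
  have hm : Measurable fun (ω : ℕ → SL d) (i : Fin n) => ω i :=
    measurable_pi_lambda _ fun i => measurable_pi_apply _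
  rw [← map_orbit_pi, ← h.2 n, Measure.map_map (measurable_orbit v n) hm,
    Measure.map_apply ((measurable_orbit v n).comp hm) hs]
  congr 1 with ω
  simp [orbit_eq_T_mulVec]

theorem projMap_mk_mem_projSet_iff (A : SL d) {v : Fin d → ℝ} (hv : v ≠ 0)
    (W : Submodule ℝ (Fin d → ℝ)) :
    projMap A (Projectivization.mk ℝ v hv) ∈ projSet W ↔
      (A : Matrix (Fin d) (Fin d) ℝ) *ᵥ v ∈ W := by
  simp [projMap, projSet, Projectivization.map_mk, Projectivization.submodule_mk]

end WalkLaw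

theorem isClosed_setOf_exists_mem_of_isCompact {Ω Y : Type*} [TopologicalSpace Ω]
    [TopologicalSpace Y] {R : Set (Ω × Y)}
    (hR : IsClosed R) {V : Set Y} (hV : IsCompact V) : IsClosed {ω | ∃ y ∈ V, (ω, y) ∈ R} := by
  have : CompactSpace V := isCompact_iff_compactSpace.1 hV
  have h : IsClosed {p : Ω × V | (p.1, (p.2 : Y)) ∈ R} := hR.preimage (by fun_prop)
  convert isClosedMap_fst_of_compactSpace _ h using 1
  ext ω
  simp

section Rigidity

variable {Ω Y : Type*} [TopologicalSpace Ω] [MeasurableSpace Ω] [OpensMeasurableSpace Ω]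

theorem exists_closedBall_measure_lt [MetricSpace Y] [ProperSpace Y] {R : Set (Ω × Y)}
    (hR : IsClosed R) (μ : ProbabilityMeasure Ω) (y : Y) {c : ℝ≥0∞}
    (h : (μ : Measure Ω) {ω | (ω, y) ∈ R} < c) :
    ∃ r > 0, (μ : Measure Ω) {ω | ∃ z ∈ Metric.closedBall y r, (ω, z) ∈ R} < c := by
  let s : ℕ → Set Ω := fun n => {ω | ∃ z ∈ Metric.closedBall y (1 / ((n : ℝ) + 1)), (ω, z) ∈ R}
  have hs (n : ℕ) : IsClosed (s n) :=
    isClosed_setOf_exists_mem_of_isCompact hR (isCompact_closedBall _ _)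
  have hanti : Antitone s := fun m n hmn ω ⟨z, hz, hω⟩ =>
    ⟨z, Metric.closedBall_subset_closedBall (Nat.one_div_le_one_div hmn) hz, hω⟩
  have hinter : ⋂ n, s n ⊆ {ω | (ω, y) ∈ R} := by
    intro ω hω
    rw [Set.mem_iInter] at hω
    choose z hz hzR using hω
    have hlim : Tendsto z atTop (nhds y) :=
      tendsto_iff_dist_tendsto_zero.2 (squeeze_zero (fun _ => dist_nonneg) hz
        tendsto_one_div_add_atTop_nhds_zero_nat)
    exact hR.mem_of_tendsto (tendsto_const_nhds.prodMk_nhds hlim) (Eventually.of_forall hzR)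
  have htend := tendsto_measure_iInter_atTop (μ := (μ : Measure Ω))
    (fun n => (hs n).measurableSet.nullMeasurableSet) hanti ⟨0, measure_ne_top _ _⟩
  obtain ⟨n, hn⟩ :=
    (htend.eventually (gt_mem_nhds ((measure_mono hinter).trans_lt h))).exists
  exact ⟨_, Nat.one_div_pos_of_nat, hn⟩

variable [HasOuterApproxClosed Ω]

theorem eventually_measure_lt_of_isClosed {μ : ProbabilityMeasure Ω} {F : Set Ω}
    (hF : IsClosed F) {c : ℝ≥0∞} (h : (μ : Measure Ω) F < c) :
    ∀ᶠ μ' in nhds μ, ((μ' : ProbabilityMeasure Ω) : Measure Ω) F < c :=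
  eventually_lt_of_limsup_lt
    ((ProbabilityMeasure.limsup_measure_closed_le_of_tendsto tendsto_id hF).trans_lt h)

theorem exists_uniform_measure_bound_lt_one [MetricSpace Y] [ProperSpace Y] {R : Set (Ω × Y)}
    (hR : IsClosed R) {K : Set (ProbabilityMeasure Ω)} (hK : IsCompact K) {X : Set Y}
    (hX : IsCompact X) (h : ∀ μ ∈ K, ∀ y ∈ X, (μ : Measure Ω) {ω | (ω, y) ∈ R} < 1) :
    ∃ c < 1, ∀ μ ∈ K, ∀ y ∈ X, (μ : Measure Ω) {ω | (ω, y) ∈ R} ≤ c := by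
  have key : ∃ c < 1, ∀ p ∈ K ×ˢ X, (p.1 : Measure Ω) {ω | (ω, p.2) ∈ R} ≤ c := by
    refine (hK.prod hX).induction_on (p := fun s => ∃ c < 1, ∀ p ∈ s,
      ((p : ProbabilityMeasure Ω × Y).1 : Measure Ω) {ω | (ω, p.2) ∈ R} ≤ c)
      ⟨0, zero_lt_one, by simp⟩ ?_ ?_ ?_
    · rintro s t hst ⟨c, hc, hct⟩
      exact ⟨c, hc, fun p hp => hct p (hst hp)⟩
    · rintro s t ⟨c, hc, hcs⟩ ⟨c', hc', hct⟩
      exact ⟨max c c', max_lt hc hc', fun p hp => hp.elim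
        (fun hp => (hcs p hp).trans (le_max_left _ _))
        (fun hp => (hct p hp).trans (le_max_right _ _))⟩
    · rintro ⟨μ, y⟩ ⟨hμ, hy⟩
      obtain ⟨c, hc, hc1⟩ := exists_between (h μ hμ y hy)
      obtain ⟨r, hr, hlt⟩ := exists_closedBall_measure_lt hR μ y hc
      refine ⟨{μ' : ProbabilityMeasure Ω |
        (μ' : Measure Ω) {ω | ∃ z ∈ Metric.closedBall y r, (ω, z) ∈ R} < c} ×ˢ Metric.closedBall y r,
        mem_nhdsWithin_of_mem_nhds (prod_mem_nhds
        (eventually_measure_lt_of_isClosed (isClosed_setOf_exists_mem_of_isCompact hR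
          (isCompact_closedBall y r)) hlt) (Metric.closedBall_mem_nhds y hr)), c, hc1, ?_⟩
      rintro ⟨μ', z⟩ ⟨hμ', hz⟩
      refine le_trans (measure_mono ?_) (le_of_lt hμ')
      exact fun ω hω => ⟨z, hz, hω⟩
  obtain ⟨c, hc, hcK⟩ := key
  exact ⟨c, hc, fun μ hμ y hy => hcK (μ, y) ⟨hμ, hy⟩⟩

end Rigidity

/-- Matrices whose columns are orthonormal. -/
def orthoFrames (d j : ℕ) : Set (Fin d → Fin j → ℝ) :=
  {V | (Matrix.of V)ᵀ * Matrix.of V = 1}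

theorem isCompact_orthoFrames (d j : ℕ) : IsCompact (orthoFrames d j) := by
  have hclosed : IsClosed (orthoFrames d j) := by
    refine isClosed_eq ?_ continuous_const
    have : Continuous fun V : Fin d → Fin j → ℝ => Matrix.of V := continuous_id
    exact this.matrix_transpose.matrix_mul this
  refine (isCompact_univ_pi fun _ : Fin d => isCompact_univ_pi fun _ : Fin j =>
    isCompact_Icc (a := (-1 : ℝ)) (b := 1)).of_isClosed_subset hclosed ?_
  intro V hV i _ a _
  have h := congrFun (congrFun hV a) a
  simp only [Matrix.mul_apply, Matrix.transpose_apply, Matrix.of_apply, Matrix.one_apply_eq] at h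
  rw [Set.mem_Icc, ← abs_le, ← sq_le_one_iff_abs_le_one, sq, ← h]
  exact Finset.single_le_sum (f := fun i => V i a * V i a) (fun i _ => mul_self_nonneg _)
    (Finset.mem_univ i)

theorem finrank_range_of_mem_orthoFrames {d j : ℕ} {V : Fin d → Fin j → ℝ}
    (hV : V ∈ orthoFrames d j) :
    Module.finrank ℝ (LinearMap.range (Matrix.of V).mulVecLin) = j := by
  have hinj : Function.Injective (Matrix.of V).mulVecLin := by
    refine Function.LeftInverse.injective (g := (Matrix.of V)ᵀ.mulVecLin) fun x => ?_
    simp only [Matrix.mulVecLin_apply, Matrix.mulVec_mulVec]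
    rw [show (Matrix.of V)ᵀ * Matrix.of V = 1 from hV, Matrix.one_mulVec]
  rw [LinearMap.finrank_range_of_inj hinj, Module.finrank_fin_fun]

theorem exists_orthoFrames_range_eq {d j : ℕ} {W : Submodule ℝ (Fin d → ℝ)}
    (hW : Module.finrank ℝ W = j) :
    ∃ V ∈ orthoFrames d j, LinearMap.range (Matrix.of V).mulVecLin = W := by
  let e : (Fin d → ℝ) ≃ₗ[ℝ] EuclideanSpace ℝ (Fin d) := (WithLp.linearEquiv 2 ℝ (Fin d → ℝ)).symm
  let W' : Submodule ℝ (EuclideanSpace ℝ (Fin d)) := W.map e.toLinearMap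
  have hW' : Module.finrank ℝ W' = j := by rw [← hW]; exact LinearEquiv.finrank_map_eq e W
  let b : OrthonormalBasis (Fin j) ℝ W' := (stdOrthonormalBasis ℝ W').reindex (finCongr hW')
  have hb (a : Fin j) : (fun i => (b a : EuclideanSpace ℝ (Fin d)) i) ∈ W := by
    obtain ⟨w, hw, h⟩ := (b a).2
    rw [← h]
    exact hw
  let V : Fin d → Fin j → ℝ := fun i a => (b a : EuclideanSpace ℝ (Fin d)) i
  have hV : V ∈ orthoFrames d j := by
    ext a a'
    have h := orthonormal_iff_ite.1 b.orthonormal a a'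
    rw [Submodule.coe_inner, PiLp.inner_apply] at h
    simp only [Matrix.mul_apply, Matrix.transpose_apply, Matrix.of_apply, Matrix.one_apply, V]
    rw [← h]
    exact Finset.sum_congr rfl fun i _ => by simp [mul_comm]
  refine ⟨V, hV, Submodule.eq_of_le_of_finrank_eq ?_
    ((finrank_range_of_mem_orthoFrames hV).trans hW.symm)⟩
  rw [Matrix.range_mulVecLin, Submodule.span_le]
  rintro _ ⟨a, rfl⟩
  exact hb a

theorem map_range_le_range_iff {d j : ℕ} (A : Matrix (Fin d) (Fin d) ℝ)
    {V W : Fin d → Fin j → ℝ} (hW : W ∈ orthoFrames d j) :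
    (LinearMap.range (Matrix.of V).mulVecLin).map A.toLin' ≤
        LinearMap.range (Matrix.of W).mulVecLin ↔
      Matrix.of W * (Matrix.of W)ᵀ * A * Matrix.of V = A * Matrix.of V := by
  constructor
  · intro h
    refine Matrix.ext_of_mulVec_single fun a => ?_
    obtain ⟨z, hz⟩ := h (Submodule.mem_map_of_mem ⟨Pi.single a 1, rfl⟩)
    simp only [Matrix.mulVecLin_apply, Matrix.toLin'_apply] at hz
    rw [Matrix.mul_assoc _ A, ← Matrix.mulVec_mulVec, ← Matrix.mulVec_mulVec _ A, ← hz,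
      Matrix.mulVec_mulVec, Matrix.mul_assoc,
      show (Matrix.of W)ᵀ * Matrix.of W = 1 from hW, Matrix.mul_one]
  · rintro h _ ⟨_, ⟨x, rfl⟩, rfl⟩
    refine ⟨((Matrix.of W)ᵀ * A * Matrix.of V) *ᵥ x, ?_⟩
    simp only [Matrix.mulVecLin_apply, Matrix.toLin'_apply, Matrix.mulVec_mulVec]
    rw [← h]
    simp only [Matrix.mul_assoc]

theorem finrank_map_SL {d : ℕ} (A : SL d) (W : Submodule ℝ (Fin d → ℝ)) :
    Module.finrank ℝ (W.map (Matrix.toLin' (A : Matrix (Fin d) (Fin d) ℝ))) =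
      Module.finrank ℝ W :=
  (Submodule.equivMapOfInjective _ (toLin'_injective A) W).finrank_eq.symm

theorem toLin'_surjective {d : ℕ} (A : SL d) :
    Function.Surjective (Matrix.toLin' (A : Matrix (Fin d) (Fin d) ℝ)) :=
  LinearMap.injective_iff_surjective.1 (toLin'_injective A)

theorem finrank_comap_SL {d : ℕ} (A : SL d) (W : Submodule ℝ (Fin d → ℝ)) :
    Module.finrank ℝ (W.comap (Matrix.toLin' (A : Matrix (Fin d) (Fin d) ℝ))) =
      Module.finrank ℝ W := by
  rw [← finrank_map_SL A, Submodule.map_comap_eq_of_surjective (toLin'_surjective A)]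

theorem exists_rigidity_bound {d : ℕ} {K : Set (ProbabilityMeasure (SL d))} (hK : IsCompact K)
    {j N : ℕ} (hN : 0 < N)
    (hsp : ¬ ∃ μ ∈ K, ∃ U U' : Set (Fin d → ℝ), IsFiniteUnionOfDimSubspaces j U ∧
      IsFiniteUnionOfDimSubspaces j U' ∧
      ∀ᵐ (A : SL d) ∂(μ : Measure (SL d)),
        (fun v => Matrix.toLin' ((A : Matrix (Fin d) (Fin d) ℝ)) v) '' U = U') :
    ∃ c : ℝ, 0 ≤ c ∧ c < 1 ∧ ∀ μ ∈ K, ∀ l l' : Fin N → Submodule ℝ (Fin d → ℝ),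
      (∀ i, Module.finrank ℝ (l i) = j) → (∀ i, Module.finrank ℝ (l' i) = j) →
      (μ : Measure (SL d)).real {A | Submodule.map (Matrix.toLin'
        (A : Matrix (Fin d) (Fin d) ℝ)) '' Set.range l = Set.range l'} ≤ c := by
  let Y := (Fin N → Fin d → Fin j → ℝ) × (Fin N → Fin d → Fin j → ℝ)
  let E (i k : Fin N) : Set (SL d × Y) := {p | Matrix.of (p.2.2 k) * (Matrix.of (p.2.2 k))ᵀ *
    (p.1 : Matrix (Fin d) (Fin d) ℝ) * Matrix.of (p.2.1 i) =
      (p.1 : Matrix (Fin d) (Fin d) ℝ) * Matrix.of (p.2.1 i)}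
  have hE (i k : Fin N) : IsClosed (E i k) := by
    have hA : Continuous fun p : SL d × Y => (p.1 : Matrix (Fin d) (Fin d) ℝ) :=
      continuous_coe_SL.comp continuous_fst
    have hV : Continuous fun p : SL d × Y => Matrix.of (p.2.1 i) := by
      exact (continuous_apply i).comp (continuous_fst.comp continuous_snd)
    have hW : Continuous fun p : SL d × Y => Matrix.of (p.2.2 k) := by
      exact (continuous_apply k).comp (continuous_snd.comp continuous_snd)
    exact isClosed_eq (((hW.matrix_mul hW.matrix_transpose).matrix_mul hA).matrix_mul hV)
      (hA.matrix_mul hV)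
  let R : Set (SL d × Y) := (⋂ i, ⋃ k, E i k) ∩ ⋂ k, ⋃ i, E i k
  have hR : IsClosed R :=
    (isClosed_iInter fun i => isClosed_iUnion_of_finite fun k => hE i k).inter
      (isClosed_iInter fun k => isClosed_iUnion_of_finite fun i => hE i k)
  let F : Set (Fin N → Fin d → Fin j → ℝ) := Set.univ.pi fun _ => orthoFrames d j
  have hF : IsCompact F := isCompact_univ_pi fun _ => isCompact_orthoFrames d j
  let sp (V : Fin N → Fin d → Fin j → ℝ) (i : Fin N) : Submodule ℝ (Fin d → ℝ) :=
    LinearMap.range (Matrix.of (V i)).mulVecLin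
  have hsp_dim {V} (hV : V ∈ F) (i : Fin N) : Module.finrank ℝ (sp V i) = j :=
    finrank_range_of_mem_orthoFrames (hV i trivial)
  have hE_iff {V W} (hV : V ∈ F) (hW : W ∈ F) (A : SL d) (i k : Fin N) :
      (A, (V, W)) ∈ E i k ↔
        (sp V i).map (Matrix.toLin' (A : Matrix (Fin d) (Fin d) ℝ)) = sp W k := by
    refine (map_range_le_range_iff _ (hW k trivial)).symm.trans ⟨fun h => ?_, le_of_eq⟩
    refine Submodule.eq_of_le_of_finrank_eq h ?_
    exact (finrank_map_SL A _).trans ((hsp_dim hV i).trans (hsp_dim hW k).symm)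
  have hR_iff {V W} (hV : V ∈ F) (hW : W ∈ F) (A : SL d) : (A, (V, W)) ∈ R ↔
      Submodule.map (Matrix.toLin' (A : Matrix (Fin d) (Fin d) ℝ)) '' Set.range (sp V) =
        Set.range (sp W) := by
    simp only [R, Set.mem_inter_iff, Set.mem_iInter, Set.mem_iUnion, hE_iff hV hW,
      ← Set.range_comp, Set.Subset.antisymm_iff, Set.range_subset_iff, Set.mem_range,
      Function.comp_apply]
    simp only [eq_comm]
  have hunion {V} (hV : V ∈ F) :
      IsFiniteUnionOfDimSubspaces j (⋃ W ∈ Set.range (sp V), (W : Set (Fin d → ℝ))) := by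
    refine ⟨Set.range (sp V), Set.finite_range _, ⟨_, ⟨⟨0, hN⟩, rfl⟩⟩, ?_, rfl⟩
    rintro _ ⟨i, rfl⟩
    exact hsp_dim hV i
  have hlt : ∀ μ ∈ K, ∀ y ∈ F ×ˢ F, (μ : Measure (SL d)) {A | (A, y) ∈ R} < 1 := by
    rintro μ hμ ⟨V, W⟩ ⟨hV, hW⟩
    refine lt_of_le_of_ne prob_le_one fun h1 => hsp ⟨μ, hμ, _, _, hunion hV, hunion hW, ?_⟩
    have hmeas : MeasurableSet {A | (A, ((V, W) : Y)) ∈ R} :=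
      (hR.preimage (by fun_prop : Continuous fun A : SL d => (A, ((V, W) : Y)))).measurableSet
    filter_upwards [(mem_ae_iff_prob_eq_one hmeas).2 h1] with A hA
    rw [← (hR_iff hV hW A).1 hA, Set.biUnion_image, Set.image_iUnion₂]
    rfl
  obtain ⟨c, hc, hcK⟩ := exists_uniform_measure_bound_lt_one hR hK (hF.prod hF) hlt
  refine ⟨c.toReal, ENNReal.toReal_nonneg, ?_, fun μ hμ l l' hl hl' => ?_⟩
  · simpa using (ENNReal.toReal_lt_toReal hc.ne_top ENNReal.one_ne_top).2 hc
  · choose V hV hVl using fun i => exists_orthoFrames_range_eq (hl i)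
    choose W hW hWl using fun i => exists_orthoFrames_range_eq (hl' i)
    refine ENNReal.toReal_mono hc.ne_top ((measure_mono fun A hA => ?_).trans
      (hcK μ hμ (V, W) ⟨fun i _ => hV i, fun i _ => hW i⟩))
    refine (hR_iff (fun i _ => hV i) (fun i _ => hW i) A).2 ?_
    rwa [show sp V = l from funext hVl, show sp W = l' from funext hWl]

theorem measurableSet_submodule {d : ℕ} (W : Submodule ℝ (Fin d → ℝ)) :
    MeasurableSet (W : Set (Fin d → ℝ)) :=
  W.closed_of_finiteDimensional.measurableSet

theorem integrable_walkLaw_comap {d : ℕ} (μ : ℕ → ProbabilityMeasure (SL d)) (v : Fin d → ℝ)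
    (n : ℕ) (W : Submodule ℝ (Fin d → ℝ)) :
    Integrable (fun A : SL d => (walkLaw μ v n).real
      (W.comap (Matrix.toLin' (A : Matrix (Fin d) (Fin d) ℝ)))) (μ n : Measure (SL d)) := by
  have hm : Measurable fun A : SL d => (walkLaw μ v n).real
      (W.comap (Matrix.toLin' (A : Matrix (Fin d) (Fin d) ℝ))) :=
    (measurable_walkLaw_preimage μ v n (measurableSet_submodule W)).ennreal_toReal
  refine Integrable.of_bound hm.aestronglyMeasurable 1 (Eventually.of_forall fun A => ?_)
  rw [Real.norm_of_nonneg measureReal_nonneg]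
  exact measureReal_le_one

theorem walkLaw_succ_real {d : ℕ} (μ : ℕ → ProbabilityMeasure (SL d)) (v : Fin d → ℝ)
    (n : ℕ) (W : Submodule ℝ (Fin d → ℝ)) :
    (walkLaw μ v (n + 1)).real W = ∫ A, (walkLaw μ v n).real
      (W.comap (Matrix.toLin' (A : Matrix (Fin d) (Fin d) ℝ))) ∂(μ n : Measure (SL d)) := by
  have h := integral_toReal
    (measurable_walkLaw_preimage μ v n (measurableSet_submodule W)).aemeasurable
    (μ := (μ n : Measure (SL d))) (Eventually.of_forall fun A => measure_lt_top _ _)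
  rw [measureReal_def, walkLaw_succ_apply μ v n (measurableSet_submodule W), ← h]
  rfl

theorem walkLaw_real_le_of_le {d : ℕ} {μ : ℕ → ProbabilityMeasure (SL d)} {v : Fin d → ℝ}
    {n n' : ℕ} (hn : n ≤ n') {j : ℕ} {M : ℝ}
    (h : ∀ W : Submodule ℝ (Fin d → ℝ), Module.finrank ℝ W = j → (walkLaw μ v n).real W ≤ M)
    {W : Submodule ℝ (Fin d → ℝ)} (hW : Module.finrank ℝ W = j) :
    (walkLaw μ v n').real W ≤ M := by
  induction n', hn using Nat.le_induction generalizing W with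
  | base => exact h W hW
  | succ n' _ ih =>
    rw [walkLaw_succ_real]
    have := integral_mono (integrable_walkLaw_comap μ v n' W) (integrable_const M)
      (fun A => ih ((finrank_comap_SL A W).trans hW))
    simpa using this

/-- The `j`-dimensional subspaces whose probability at time `n` is at least `a`. -/
def heavySubspaces {d : ℕ} (μ : ℕ → ProbabilityMeasure (SL d)) (v : Fin d → ℝ) (j n : ℕ)
    (a : ℝ) : Set (Submodule ℝ (Fin d → ℝ)) :=
  {W | Module.finrank ℝ W = j ∧ a ≤ (walkLaw μ v n).real W}

theorem heavySubspaces_anti {d : ℕ} (μ : ℕ → ProbabilityMeasure (SL d)) (v : Fin d → ℝ)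
    (j n : ℕ) : Antitone (heavySubspaces μ v j n) :=
  fun _ _ hab _ hW => ⟨hW.1, hab.trans hW.2⟩

theorem encard_heavySubspaces_le {d : ℕ} (μ : ℕ → ProbabilityMeasure (SL d)) (v : Fin d → ℝ)
    (j n : ℕ) {N : ℕ} {a δ : ℝ} (hN : 1 < N * (a - N * δ))
    (hδ : ∀ W : Submodule ℝ (Fin d → ℝ), Module.finrank ℝ W ≤ j → (walkLaw μ v n).real W ≤ δ) :
    (heavySubspaces μ v (j + 1) n a).encard ≤ N := by
  classical
  by_contra! hlt
  obtain ⟨t, ht, htN⟩ := Set.exists_subset_encard_eq hlt.le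
  have htf : t.Finite := Set.finite_of_encard_eq_coe htN
  lift t to Finset (Submodule ℝ (Fin d → ℝ)) using htf
  rw [Set.encard_coe_eq_coe_finsetCard, Nat.cast_inj] at htN
  set ν := walkLaw μ v n
  have hδ0 : 0 ≤ δ := measureReal_nonneg.trans (hδ ⊥ (by simp))
  let D (W : Submodule ℝ (Fin d → ℝ)) : Set (Fin d → ℝ) :=
    W \ ⋃ W' ∈ t.erase W, ((W ⊓ W' : Submodule ℝ (Fin d → ℝ)) : Set (Fin d → ℝ))
  have hDm (W) : MeasurableSet (D W) := (measurableSet_submodule W).diff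
    (Finset.measurableSet_biUnion _ fun W' _ => measurableSet_submodule _)
  have hD {W} (hW : W ∈ t) : a - N * δ ≤ ν.real (D W) := by
    have h1 : ν.real (⋃ W' ∈ t.erase W, ((W ⊓ W' : Submodule ℝ (Fin d → ℝ)) :
        Set (Fin d → ℝ))) ≤ N * δ := by
      refine (measureReal_biUnion_finset_le _ _).trans ?_
      refine (Finset.sum_le_card_nsmul _ _ δ fun W' hW' => hδ _ ?_).trans ?_
      · have hne := Finset.ne_of_mem_erase hW'
        have hW'd := (ht (Finset.mem_of_mem_erase hW')).1
        have hWd := (ht hW).1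
        have hlt : W ⊓ W' < W := lt_of_le_of_ne inf_le_left fun h =>
          hne (Submodule.eq_of_le_of_finrank_eq (inf_eq_left.1 h) (hWd.trans hW'd.symm)).symm
        have := Submodule.finrank_lt_finrank_of_lt hlt
        omega
      · rw [nsmul_eq_mul]
        gcongr
        exact_mod_cast (Finset.card_le_card (Finset.erase_subset _ _)).trans htN.le
    have h2 := le_measureReal_sdiff (μ := ν) (s₁ := (W : Set (Fin d → ℝ)))
      (s₂ := ⋃ W' ∈ t.erase W, ((W ⊓ W' : Submodule ℝ (Fin d → ℝ)) : Set (Fin d → ℝ)))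
      (h := measure_ne_top _ _)
    have h3 := (ht hW).2
    change _ ≤ ν.real (D W) at h2
    linarith
  obtain ⟨W, hW, W', hW', hne, x, hx, hx'⟩ :=
    exists_nonempty_inter_of_measureReal_univ_lt_sum_measureReal (μ := ν) (s := t) (t := D)
      (fun W _ => hDm W) (by
        rw [probReal_univ]
        refine hN.trans_le ?_
        rw [← nsmul_eq_mul]
        exact (congrArg (· • (a - N * δ)) htN.symm).le.trans
          (Finset.card_nsmul_le_sum t _ _ fun W hW => hD hW))
  exact hx.2 (Set.mem_biUnion (Finset.mem_erase.2 ⟨hne.symm, hW'⟩) ⟨hx.1, hx'.1⟩)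

theorem measure_comap_notMem_heavySubspaces {d : ℕ} {μ : ℕ → ProbabilityMeasure (SL d)}
    {v : Fin d → ℝ} {j n : ℕ} {M η η' : ℝ}
    (hM : ∀ W : Submodule ℝ (Fin d → ℝ), Module.finrank ℝ W = j → (walkLaw μ v n).real W ≤ M)
    {W : Submodule ℝ (Fin d → ℝ)} (hW : W ∈ heavySubspaces μ v j (n + 1) (M - η')) :
    η * (μ n : Measure (SL d)).real {A | W.comap (Matrix.toLin'
      (A : Matrix (Fin d) (Fin d) ℝ)) ∉ heavySubspaces μ v j n (M - η)} ≤ η' := by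
  have hint := integrable_walkLaw_comap μ v n W
  have h0 (A : SL d) : 0 ≤ M - (walkLaw μ v n).real
      (W.comap (Matrix.toLin' (A : Matrix (Fin d) (Fin d) ℝ))) :=
    sub_nonneg.2 (hM _ ((finrank_comap_SL A W).trans hW.1))
  have hmarkov := mul_meas_ge_le_integral_of_nonneg (Eventually.of_forall h0)
    ((integrable_const M).sub hint) η
  rw [integral_sub (integrable_const M) hint, ← walkLaw_succ_real] at hmarkov
  have hW2 := hW.2
  rw [integral_const, probReal_univ, one_smul] at hmarkov
  rcases le_total η 0 with hη | hη
  · have hM' := (walkLaw_real_le_of_le n.le_succ hM hW.1)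
    have := mul_nonpos_of_nonpos_of_nonneg hη (measureReal_nonneg (μ := (μ n : Measure (SL d)))
      (s := {A | W.comap (Matrix.toLin'
        (A : Matrix (Fin d) (Fin d) ℝ)) ∉ heavySubspaces μ v j n (M - η)}))
    linarith
  refine (mul_le_mul_of_nonneg_left (measureReal_mono fun A hA => ?_) hη).trans
    (hmarkov.trans (by linarith))
  by_contra hlt
  rw [Set.mem_ofPred_eq, not_le] at hlt
  exact hA ⟨(finrank_comap_SL A W).trans hW.1, by linarith⟩

/-- If the rigidity bound holds, then passing from time `n` to time `n + 1` strictly decreases the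
number of subspaces whose probability is close to the bound `M`. -/
theorem heavySubspaces_succ_eq_empty_or_encard_lt {d : ℕ}
    {K : Set (ProbabilityMeasure (SL d))} {μ : ℕ → ProbabilityMeasure (SL d)}
    {v : Fin d → ℝ} {j n N : ℕ} {c M η η' : ℝ} (hμ : μ n ∈ K)
    (hc : ∀ μ ∈ K, ∀ l l' : Fin N → Submodule ℝ (Fin d → ℝ),
      (∀ i, Module.finrank ℝ (l i) = j) → (∀ i, Module.finrank ℝ (l' i) = j) →
      (μ : Measure (SL d)).real {A | Submodule.map (Matrix.toLin'
        (A : Matrix (Fin d) (Fin d) ℝ)) '' Set.range l = Set.range l'} ≤ c)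
    (hc0 : 0 ≤ c)
    (hM : ∀ W : Submodule ℝ (Fin d → ℝ), Module.finrank ℝ W = j → (walkLaw μ v n).real W ≤ M)
    (hη : 0 < η) (hηη' : N * η' < (1 - c) * η)
    (hcard : (heavySubspaces μ v j n (M - η)).encard ≤ N)
    (hcard' : (heavySubspaces μ v j (n + 1) (M - η')).encard ≤ N) :
    heavySubspaces μ v j (n + 1) (M - η') = ∅ ∨
      (heavySubspaces μ v j (n + 1) (M - η')).encard <
        (heavySubspaces μ v j n (M - η)).encard := by
  set S := heavySubspaces μ v j n (M - η)
  set S' := heavySubspaces μ v j (n + 1) (M - η')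
  by_contra! hcon
  obtain ⟨hne', hle⟩ := hcon
  have hSf : S.Finite := Set.finite_of_encard_le_coe hcard
  have hSf' : S'.Finite := Set.finite_of_encard_le_coe hcard'
  let m : Measure (SL d) := μ n
  let B (W : Submodule ℝ (Fin d → ℝ)) : Set (SL d) :=
    {A | W.comap (Matrix.toLin' (A : Matrix (Fin d) (Fin d) ℝ)) ∉ S}
  let G : Set (SL d) := {A | ∀ W ∈ S', W.comap (Matrix.toLin'
    (A : Matrix (Fin d) (Fin d) ℝ)) ∈ S}
  have hB : m.real (⋃ W ∈ hSf'.toFinset, B W) ≤ N * (η' / η) := by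
    have hη'0 : 0 ≤ η' / η := by
      obtain ⟨W, hW⟩ := hne'
      have hW2 := hW.2
      have := walkLaw_real_le_of_le n.le_succ hM hW.1
      exact div_nonneg (by linarith) hη.le
    refine (measureReal_biUnion_finset_le _ _).trans ?_
    refine (Finset.sum_le_card_nsmul _ _ (η' / η) fun W hW => ?_).trans ?_
    · rw [le_div_iff₀' hη]
      exact measure_comap_notMem_heavySubspaces hM (hSf'.mem_toFinset.1 hW)
    · rw [nsmul_eq_mul]
      gcongr
      rwa [hSf'.encard_eq_coe_toFinset_card, Nat.cast_le] at hcard'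
  have hG : c < m.real G := by
    have hcover : (Set.univ : Set (SL d)) ⊆ G ∪ ⋃ W ∈ hSf'.toFinset, B W := by
      intro A _
      by_cases hA : A ∈ G
      · exact Or.inl hA
      · simp only [G, Set.mem_ofPred_eq, not_forall] at hA
        obtain ⟨W, hW, hWA⟩ := hA
        exact Or.inr (Set.mem_biUnion (hSf'.mem_toFinset.2 hW) hWA)
    have h1 := (measureReal_mono (μ := m) hcover).trans (measureReal_union_le _ _)
    rw [probReal_univ] at h1
    have h2 : N * (η' / η) < 1 - c := by rwa [← mul_div_assoc, div_lt_iff₀ hη]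
    linarith
  have hSne : S.Nonempty := by
    obtain ⟨W, hW⟩ := hne'
    obtain ⟨A, hA⟩ : G.Nonempty := by
      rw [Set.nonempty_iff_ne_empty]
      intro h
      rw [h, measureReal_empty] at hG
      linarith
    exact ⟨_, hA W hW⟩
  have hparam {Q : Set (Submodule ℝ (Fin d → ℝ))} (hQ : Q.Nonempty) (hQf : Q.Finite)
      (hQN : Q.encard ≤ N) : ∃ l : Fin N → Submodule ℝ (Fin d → ℝ), Set.range l = Q := by
    have := hQ.to_subtype
    have := hQf.to_subtype
    rw [hQf.encard_eq_coe_toFinset_card, Nat.cast_le, ← Set.ncard_eq_toFinset_card Q hQf] at hQN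
    let e : Q ↪ Fin N := (Finite.equivFin Q).toEmbedding.trans (Fin.castLEEmb hQN)
    refine ⟨fun i => (Function.invFun e i : Q), ?_⟩
    rw [Set.range_comp', (Function.invFun_surjective e.injective).range_eq, Set.image_univ,
      Subtype.range_coe]
  obtain ⟨l, hl⟩ := hparam hSne hSf hcard
  obtain ⟨l', hl'⟩ := hparam hne' hSf' hcard'
  refine (hG.trans_le ?_).not_ge (hc (μ n) hμ l l' (fun i => ?_) (fun i => ?_))
  · refine measureReal_mono fun A hA => ?_
    have hinj : Function.Injective
        (Submodule.comap (Matrix.toLin' (A : Matrix (Fin d) (Fin d) ℝ))) :=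
      Submodule.comap_injective_of_surjective (toLin'_surjective A)
    have himage : Submodule.comap (Matrix.toLin' (A : Matrix (Fin d) (Fin d) ℝ)) '' S' = S :=
      (hSf'.image _).eq_of_subset_of_encard_le (Set.image_subset_iff.2 hA)
        (hle.trans_eq (hinj.encard_image S').symm)
    rw [Set.mem_ofPred_eq, hl, hl', ← himage, Set.image_image]
    simp [Submodule.map_comap_eq_of_surjective (toLin'_surjective A)]
  · exact (hl.subset ⟨i, rfl⟩ : l i ∈ S).1
  · exact (hl'.subset ⟨i, rfl⟩ : l' i ∈ S').1

theorem exists_walkLaw_decrease {d : ℕ} {K : Set (ProbabilityMeasure (SL d))} {j N : ℕ} {c ε : ℝ}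
    (hN : 0 < N) (hc0 : 0 ≤ c) (hc1 : c < 1)
    (hc : ∀ μ ∈ K, ∀ l l' : Fin N → Submodule ℝ (Fin d → ℝ),
      (∀ i, Module.finrank ℝ (l i) = j) → (∀ i, Module.finrank ℝ (l' i) = j) →
      (μ : Measure (SL d)).real {A | Submodule.map (Matrix.toLin'
        (A : Matrix (Fin d) (Fin d) ℝ)) '' Set.range l = Set.range l'} ≤ c)
    (hε : 0 < ε) :
    ∃ η > 0, ∀ (μ : ℕ → ProbabilityMeasure (SL d)) (v : Fin d → ℝ) (n : ℕ) (M : ℝ),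
      (∀ i, μ i ∈ K) → ε ≤ M →
      (∀ n' ≥ n, (heavySubspaces μ v j n' (ε / 2)).encard ≤ N) →
      (∀ W : Submodule ℝ (Fin d → ℝ), Module.finrank ℝ W = j → (walkLaw μ v n).real W ≤ M) →
      ∀ W : Submodule ℝ (Fin d → ℝ), Module.finrank ℝ W = j →
        (walkLaw μ v (n + (N + 1))).real W ≤ M - η := by
  have hN' : (0 : ℝ) < N := by exact_mod_cast hN
  have hN1 : (1 : ℝ) ≤ N := by exact_mod_cast hN
  let q : ℝ := (1 - c) / (2 * N)
  have hq0 : 0 < q := div_pos (by linarith) (by linarith)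
  have hq1 : q ≤ 1 := (div_le_one (by linarith)).2 (by linarith)
  have hNq : N * q = (1 - c) / 2 := by simp only [q]; field_simp
  let η (t : ℕ) : ℝ := ε / 2 * q ^ t
  have hη0 (t : ℕ) : 0 < η t := by positivity
  have hηε (t : ℕ) : η t ≤ ε / 2 :=
    mul_le_of_le_one_right (by linarith) (pow_le_one₀ hq0.le hq1)
  have hηs (t : ℕ) : N * η (t + 1) < (1 - c) * η t := by
    have h : N * η (t + 1) = (1 - c) / 2 * η t := by rw [← hNq]; simp only [η]; ring
    rw [h]
    exact mul_lt_mul_of_pos_right (by linarith) (hη0 t)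
  refine ⟨η (N + 1), hη0 _, fun μ v n M hμ hεM hfin hM W hW => ?_⟩
  have hcard (t : ℕ) : (heavySubspaces μ v j (n + t) (M - η t)).encard ≤ N :=
    (Set.encard_le_encard (heavySubspaces_anti μ v j _ (by linarith [hηε t]))).trans
      (hfin _ (Nat.le_add_right n t))
  have key (t : ℕ) : heavySubspaces μ v j (n + t) (M - η t) = ∅ ∨
      (heavySubspaces μ v j (n + t) (M - η t)).encard + t ≤ N := by
    induction t with
    | zero => right; simpa using hcard 0
    | succ t ih =>
      refine (heavySubspaces_succ_eq_empty_or_encard_lt (hμ (n + t)) hc hc0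
        (fun W hW => walkLaw_real_le_of_le (Nat.le_add_right n t) hM hW) (hη0 t) (hηs t)
        (hcard t) (hcard (t + 1))).imp_right fun hlt => ?_
      rcases ih with h | h
      · simp [h] at hlt
      · refine le_trans ?_ h
        rw [Nat.cast_succ, add_comm (t : ℕ∞), ← add_assoc]
        gcongr
        exact Order.add_one_le_of_lt hlt
  have hempty := (key (N + 1)).resolve_right fun h => by
    have := le_add_self.trans h
    rw [Nat.cast_le] at this
    omega
  by_contra! hlt
  exact (Set.eq_empty_iff_forall_notMem.1 hempty W) ⟨hW, hlt.le⟩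

theorem exists_walkLaw_le {d : ℕ} {K : Set (ProbabilityMeasure (SL d))} (hK : IsCompact K)
    (m : ℕ)
    (hsp : ∀ j : ℕ, 1 ≤ j → j ≤ m →
      ¬ ∃ μ ∈ K, ∃ U U' : Set (Fin d → ℝ), IsFiniteUnionOfDimSubspaces j U ∧
          IsFiniteUnionOfDimSubspaces j U' ∧
          ∀ᵐ (A : SL d) ∂(μ : Measure (SL d)),
            (fun v => Matrix.toLin' ((A : Matrix (Fin d) (Fin d) ℝ)) v) '' U = U')
    {ε : ℝ} (hε : 0 < ε) :
    ∃ k₀ : ℕ, ∀ k ≥ k₀, ∀ v : Fin d → ℝ, v ≠ 0 → ∀ μ : ℕ → ProbabilityMeasure (SL d),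
      (∀ i, μ i ∈ K) → ∀ W : Submodule ℝ (Fin d → ℝ), Module.finrank ℝ W ≤ m →
        (walkLaw μ v k).real W ≤ ε := by
  induction m generalizing ε with
  | zero =>
    refine ⟨0, fun k _ v hv μ _ W hW => ?_⟩
    rw [Submodule.finrank_eq_zero.1 (Nat.le_zero.1 hW), measureReal_def, Submodule.bot_coe,
      walkLaw_singleton_zero μ hv]
    exact hε.le
  | succ m ih =>
    obtain ⟨N, hNε⟩ := exists_nat_gt (max 1 (4 / ε))
    have hN1 : (1 : ℝ) < N := (le_max_left _ _).trans_lt hNε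
    have hN4 : 4 < N * ε := (div_lt_iff₀ hε).1 ((le_max_right _ _).trans_lt hNε)
    have hN : 0 < N := by exact_mod_cast zero_lt_one.trans hN1
    have hδ : 0 < ε / (4 * N) := by positivity
    obtain ⟨k₀, hk₀⟩ := ih (fun j h1 hj => hsp j h1 (hj.trans m.le_succ)) hδ
    obtain ⟨c, hc0, hc1, hc⟩ := exists_rigidity_bound hK hN (hsp (m + 1) (by omega) le_rfl)
    obtain ⟨η, hη, hdec⟩ := exists_walkLaw_decrease hN hc0 hc1 hc hε
    obtain ⟨t₀, ht₀⟩ := exists_nat_gt (1 / η)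
    refine ⟨k₀ + t₀ * (N + 1), fun k hk v hv μ hμ W hW => ?_⟩
    have hfin (n' : ℕ) (hn' : n' ≥ k₀) : (heavySubspaces μ v (m + 1) n' (ε / 2)).encard ≤ N := by
      refine encard_heavySubspaces_le μ v m n' (δ := ε / (4 * N)) ?_ (hk₀ n' hn' v hv μ hμ)
      have : N * (ε / 2 - N * (ε / (4 * N))) = N * ε / 4 := by field_simp; ring
      linarith
    have key (t : ℕ) : ∀ W : Submodule ℝ (Fin d → ℝ), Module.finrank ℝ W = m + 1 →
        (walkLaw μ v (k₀ + t * (N + 1))).real W ≤ max ε (1 - t * η) := by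
      induction t with
      | zero => exact fun W _ => measureReal_le_one.trans (by simp)
      | succ t iht =>
        intro W hW
        have := hdec μ v _ _ hμ (le_max_left ε (1 - t * η))
          (fun n' hn' => hfin n' ((Nat.le_add_right _ _).trans hn')) iht W hW
        rw [Nat.succ_mul, ← Nat.add_assoc]
        refine this.trans ?_
        rw [← max_sub_sub_right]
        push_cast
        exact max_le_max (by linarith) (by linarith)
    rcases hW.lt_or_eq with hW | hW
    · refine (hk₀ k (by omega) v hv μ hμ W (by omega)).trans ?_
      exact div_le_self hε.le (by linarith)
    · refine (walkLaw_real_le_of_le hk (key t₀) hW).trans (max_le le_rfl ?_)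
      have := (div_lt_iff₀ hη).1 ht₀
      linarith

/-- **Subspaces avoidance** (Proposition 1.10).
Under the log-moment and measures conditions, if moreover for every `j ≤ m` there is no
finite union of `j`-dimensional subspaces with a deterministic image, then for every
`ε > 0` there is `k₀` such that for every `k ≥ k₀`, every starting point `x₀ ∈ ℝP^{d-1}`,
every `m`-dimensional subspace `L`, and every choice of measures from `K`, the probability
that the random composition sends `x₀` into `[L]` is less than `ε`. -/
theorem subspaces_avoidance
    (d : ℕ) (hd : 0 < d)
    (K : Set (ProbabilityMeasure (SL d))) (hK : IsCompact K)
    (hlog : ∀ μ ∈ K, LogMomentCondition μ)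
    (hmeas : ∀ μ ∈ K, MeasuresCondition μ)
    (m : ℕ) (hm1 : 1 ≤ m) (hmd : m ≤ d - 1)
    (hsp : ∀ j : ℕ, 1 ≤ j → j ≤ m →
      ¬ ∃ μ ∈ K, ∃ U U' : Set (Fin d → ℝ), IsFiniteUnionOfDimSubspaces j U ∧
          IsFiniteUnionOfDimSubspaces j U' ∧
          ∀ᵐ (A : SL d) ∂(μ : Measure (SL d)),
            (fun v => Matrix.toLin' ((A : Matrix (Fin d) (Fin d) ℝ)) v) '' U = U') :
    ∀ ε : ℝ, 0 < ε → ∃ k₀ : ℕ, ∀ k : ℕ, k₀ ≤ k →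
      ∀ x₀ : Proj d, ∀ Lsub : Submodule ℝ (Fin d → ℝ), Module.finrank ℝ Lsub = m →
        ∀ (μ : ℕ → ProbabilityMeasure (SL d)), (∀ i, μ i ∈ K) →
          ∀ ℙ : Measure (ℕ → SL d), IsProductMeasure μ ℙ →
            ℙ {ω | projMap (T ω k) x₀ ∈ projSet Lsub} < ENNReal.ofReal ε := by
  intro ε hε
  obtain ⟨k₀, hk₀⟩ := exists_walkLaw_le hK m hsp (half_pos hε)
  refine ⟨k₀, fun k hk x₀ W hW μ hμ ℙ hℙ => ?_⟩
  induction x₀ using Projectivization.ind with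
  | h v hv =>
    simp only [projMap_mk_mem_projSet_iff]
    have h := hℙ.apply_eq_walkLaw v k (measurableSet_submodule W)
    simp only [SetLike.mem_coe] at h
    rw [h, ENNReal.lt_ofReal_iff_toReal_lt (measure_ne_top _ _)]
    exact (hk₀ k hk v hv μ hμ W hW.le).trans_lt (half_lt_self hε)
end
end

section
/- Uniform positivity of the Furstenberg entropy. Let K be a compact set (in the weak-* topology) of Borel probability measures on Homeo(X), and assume that for every μ ∈ K there are no Borel probability measures ν, ν' on X such that f_*ν = ν' for μ-a.e. f ∈ Homeo(X). Then 𝐡 := inf_{μ ∈ K} inf_ν Φ_μ(ν) > 0, where the inner infimum is over all Borel probability measures ν on X. -/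
open MeasureTheory
open scoped ENNReal

noncomputable section

/-- Topology of uniform convergence (= compact-open topology) on `Homeo(X)`. -/
instance homeoTopologicalSpace {X : Type*} [TopologicalSpace X] :
    TopologicalSpace (X ≃ₜ X) :=
  TopologicalSpace.induced (fun f : X ≃ₜ X => (f : C(X, X))) inferInstance

instance homeoMeasurableSpace {X : Type*} [TopologicalSpace X] :
    MeasurableSpace (X ≃ₜ X) := borel _

instance homeoBorelSpace {X : Type*} [TopologicalSpace X] :
    BorelSpace (X ≃ₜ X) := ⟨rfl⟩

/-- `μ * ν = ∫ f_* ν dμ(f)`: the law of `f x` with `f ∼ μ`, `x ∼ ν` independent. -/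
def mconv {X : Type*} [TopologicalSpace X] [MeasurableSpace X]
    (μ : Measure (X ≃ₜ X)) (ν : Measure X) : Measure X :=
  μ.bind fun f => ν.map f

/-- The maximal weight of an atom of a measure. -/
def maxAtom {X : Type*} [MeasurableSpace X] (ν : Measure X) : ℝ≥0∞ :=
  ⨆ x : X, ν {x}

/-- Iterated convolution `μₙ * ⋯ * μ₁ * ν`. -/
def iterConv {X : Type*} [TopologicalSpace X] [MeasurableSpace X]
    (μ : ℕ → ProbabilityMeasure (X ≃ₜ X)) (ν : Measure X) : ℕ → Measure X
  | 0 => ν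
  | n + 1 => mconv (μ n : Measure (X ≃ₜ X)) (iterConv μ ν n)

open scoped Classical in
/-- Relative entropy (Kullback–Leibler divergence) `h(ν | ν')`. -/
def relEnt {X : Type*} [MeasurableSpace X] (ν ν' : Measure X) : ℝ≥0∞ :=
  if ν ≪ ν' ∧ Integrable (fun x => Real.log (ν.rnDeriv ν' x).toReal) ν
  then ENNReal.ofReal (∫ x, Real.log (ν.rnDeriv ν' x).toReal ∂ν)
  else ⊤

/-- The Furstenberg entropy `Φ_μ(ν) = ∫ h(f_*ν | μ*ν) dμ(f)`. -/
def furstEnt {X : Type*} [TopologicalSpace X] [MeasurableSpace X]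
    (μ : Measure (X ≃ₜ X)) (ν : Measure X) : ℝ≥0∞ :=
  ∫⁻ f, relEnt (ν.map f) (mconv μ ν) ∂μ

/-- The conditional version `Φ_μ(ν | ν') = ∫ h(f_*ν | ν') dμ(f)`. -/
def furstEntCond {X : Type*} [TopologicalSpace X] [MeasurableSpace X]
    (μ : Measure (X ≃ₜ X)) (ν ν' : Measure X) : ℝ≥0∞ :=
  ∫⁻ f, relEnt (ν.map f) ν' ∂μ

/-- The law of `f ∘ g`, where `f ∼ μ'` and `g ∼ μ` independently. -/
def hconv {X : Type*} [TopologicalSpace X] (μ' μ : Measure (X ≃ₜ X)) :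
    Measure (X ≃ₜ X) :=
  (μ'.prod μ).map fun p => p.2.trans p.1

/-- Total variation distance between two (finite Borel) measures. -/
def tvDist {X : Type*} [MeasurableSpace X] (α β : Measure X) : ℝ≥0∞ :=
  (⨆ (s : Set X) (_ : MeasurableSet s), (α s - β s)) +
    (⨆ (s : Set X) (_ : MeasurableSet s), (β s - α s))

/-- Sum of squares of the weights of atoms. -/
def sqAtomMass {X : Type*} [MeasurableSpace X] (ν : Measure X) : ℝ≥0∞ :=
  ∑' x : X, (ν {x}) ^ 2

/-- The measure `Σ_x ν({x})² δ_x`. -/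
def sqAtomMeasure {X : Type*} [MeasurableSpace X] (ν : Measure X) : Measure X :=
  Measure.sum fun x : X => (ν {x}) ^ 2 • Measure.dirac x


namespace FurstenbergEntropy

open Filter Topology TopologicalSpace Set

/-- A Pinsker-type inequality for the relative entropy, tested against a bounded function. -/
lemma ofReal_sq_integral_sub_le_relEnt {X : Type*} [MeasurableSpace X] (α β : Measure X)
    [IsProbabilityMeasure α] [IsProbabilityMeasure β] {ψ : X → ℝ} (hψ : Measurable ψ) {C : ℝ}
    (hC : 0 < C) (hψC : ∀ x, |ψ x| ≤ C) :
    ENNReal.ofReal ((∫ x, ψ x ∂α - ∫ x, ψ x ∂β) ^ 2 / (4 * C ^ 2)) ≤ relEnt α β := by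
  unfold relEnt
  split_ifs with hαβ
  swap
  · exact le_top
  obtain ⟨hac, hint⟩ := hαβ
  apply ENNReal.ofReal_le_ofReal
  have integrable_of_bounded {γ : Measure X} [IsProbabilityMeasure γ] : Integrable ψ γ :=
    .of_bound hψ.aestronglyMeasurable C (ae_of_all _ fun x ↦ hψC x)
  have abs_integral_le {γ : Measure X} [IsProbabilityMeasure γ] : |∫ x, ψ x ∂γ| ≤ C := by
    simpa using norm_integral_le_of_norm_le_const (μ := γ) (f := ψ) (ae_of_all _ hψC)
  set d := ∫ x, ψ x ∂α - ∫ x, ψ x ∂β with hd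
  have hdC : |d| ≤ 2 * C := by
    have := abs_sub (∫ x, ψ x ∂α) (∫ x, ψ x ∂β)
    linarith [abs_integral_le (γ := α), abs_integral_le (γ := β)]
  set t := d / (2 * C ^ 2) with ht
  have htψ (x : X) : |t * ψ x| ≤ 1 := by
    have htC : |t| ≤ 1 / C := by
      rw [ht, abs_div, abs_of_pos (by positivity : 0 < 2 * C ^ 2),
        div_le_div_iff₀ (by positivity) hC]
      nlinarith
    calc |t * ψ x| = |t| * |ψ x| := abs_mul _ _
      _ ≤ 1 / C * C := by gcongr; exact hψC x
      _ = 1 := by field_simp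
  have hexp_le (x : X) : Real.exp (t * ψ x) ≤ 1 + t * ψ x + t ^ 2 * C ^ 2 := by
    have h1 := (abs_le.1 (Real.abs_exp_sub_one_sub_id_le (htψ x))).2
    have h2 : ψ x ^ 2 ≤ C ^ 2 := sq_le_sq' (abs_le.1 (hψC x)).1 (abs_le.1 (hψC x)).2
    nlinarith [mul_le_mul_of_nonneg_left h2 (sq_nonneg t)]
  have hexp_int : Integrable (fun x ↦ Real.exp (t * ψ x)) β := by
    refine .of_bound (by fun_prop) (Real.exp 1) (ae_of_all _ fun x ↦ ?_)
    rw [Real.norm_eq_abs, Real.abs_exp]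
    exact Real.exp_le_exp.2 (abs_le.1 (htψ x)).2
  have hexp : ∫ x, Real.exp (t * ψ x) ∂β ≤ 1 + t * ∫ x, ψ x ∂β + t ^ 2 * C ^ 2 := by
    have hi : Integrable (fun x ↦ 1 + t * ψ x) β :=
      (integrable_const _).add (integrable_of_bounded.const_mul t)
    calc ∫ x, Real.exp (t * ψ x) ∂β ≤ ∫ x, (1 + t * ψ x + t ^ 2 * C ^ 2) ∂β :=
          integral_mono hexp_int (hi.add (integrable_const _)) hexp_le
      _ = _ := by
          rw [integral_add hi (integrable_const _),
            integral_add (integrable_const _) (integrable_of_bounded.const_mul t),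
            integral_const_mul]
          simp
  have hexp_pos : 0 < ∫ x, Real.exp (t * ψ x) ∂β := integral_exp_pos hexp_int
  have := isProbabilityMeasure_tilted hexp_int
  have hgibbs := InformationTheory.integral_llr_add_sub_measure_univ_nonneg
    (hac.trans (absolutelyContinuous_tilted hexp_int))
    (integrable_llr_tilted_right hac (integrable_of_bounded.const_mul t) hint hexp_int)
  rw [integral_llr_tilted_right hac (integrable_of_bounded.const_mul t) hexp_int hint,
    integral_const_mul] at hgibbs
  simp only [probReal_univ] at hgibbs
  have hlog := Real.log_le_sub_one_of_pos hexp_pos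
  have hquad : d ^ 2 / (4 * C ^ 2) = t * d - t ^ 2 * C ^ 2 := by
    rw [ht]; field_simp; ring
  have hllr : ∫ x, Real.log (α.rnDeriv β x).toReal ∂α = ∫ x, llr α β x ∂α := rfl
  rw [hquad, hllr, hd]
  linarith

section Homeo

lemma isInducing_homeo_toContinuousMap {X : Type*} [TopologicalSpace X] :
    IsInducing (fun f : X ≃ₜ X ↦ (f : C(X, X))) := ⟨rfl⟩

variable {X : Type*} [MetricSpace X] [CompactSpace X]

instance : PseudoMetrizableSpace (X ≃ₜ X) :=
  isInducing_homeo_toContinuousMap.pseudoMetrizableSpace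

instance : SecondCountableTopology (X ≃ₜ X) :=
  isInducing_homeo_toContinuousMap.secondCountableTopology

lemma continuous_homeo_eval : Continuous fun p : (X ≃ₜ X) × X ↦ p.1 p.2 :=
  (continuous_eval (F := C(X, X))).comp
    (isInducing_homeo_toContinuousMap.continuous.prodMap continuous_id)

variable [MeasurableSpace X] [BorelSpace X]

lemma measurable_homeo_map (ν : Measure X) [IsProbabilityMeasure ν] :
    Measurable fun f : X ≃ₜ X ↦ ν.map f := by
  refine Measure.measurable_of_measurable_coe _ fun s hs ↦ ?_
  have heq : (fun f : X ≃ₜ X ↦ ν.map f s) =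
      fun f ↦ ν (Prod.mk f ⁻¹' ((fun p : (X ≃ₜ X) × X ↦ p.1 p.2) ⁻¹' s)) := by
    ext f
    rw [Measure.map_apply f.continuous.measurable hs]
    rfl
  rw [heq]
  exact measurable_measure_prodMk_left (continuous_homeo_eval.measurable hs)

lemma mconv_eq_map_prod (μ : Measure (X ≃ₜ X)) [IsProbabilityMeasure μ] (ν : Measure X)
    [IsProbabilityMeasure ν] : mconv μ ν = (μ.prod ν).map fun p ↦ p.1 p.2 := by
  ext s hs
  rw [mconv, Measure.bind_apply hs (measurable_homeo_map ν).aemeasurable,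
    Measure.map_apply continuous_homeo_eval.measurable hs,
    Measure.prod_apply (continuous_homeo_eval.measurable hs)]
  refine lintegral_congr fun f ↦ ?_
  rw [Measure.map_apply f.continuous.measurable hs]
  rfl

instance (μ : Measure (X ≃ₜ X)) [IsProbabilityMeasure μ] (ν : Measure X)
    [IsProbabilityMeasure ν] : IsProbabilityMeasure (mconv μ ν) := by
  rw [mconv_eq_map_prod]
  exact Measure.isProbabilityMeasure_map continuous_homeo_eval.measurable.aemeasurable

lemma integrable_comp_homeo_eval (μ : Measure (X ≃ₜ X)) [IsProbabilityMeasure μ]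
    (ν : Measure X) [IsProbabilityMeasure ν] (φ : C(X, ℝ)) :
    Integrable (fun p : (X ≃ₜ X) × X ↦ φ (p.1 p.2)) (μ.prod ν) :=
  .of_bound (φ.continuous.comp continuous_homeo_eval).aestronglyMeasurable ‖φ‖
    (ae_of_all _ fun _ ↦ φ.norm_coe_le_norm _)

lemma integral_mconv (μ : Measure (X ≃ₜ X)) [IsProbabilityMeasure μ] (ν : Measure X)
    [IsProbabilityMeasure ν] (φ : C(X, ℝ)) :
    ∫ x, φ x ∂mconv μ ν = ∫ f : X ≃ₜ X, ∫ x, φ (f x) ∂ν ∂μ := by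
  rw [mconv_eq_map_prod, integral_map continuous_homeo_eval.measurable.aemeasurable
    φ.continuous.aestronglyMeasurable, integral_prod _ (integrable_comp_homeo_eval μ ν φ)]

/-- The variance, under `f ∼ μ`, of `∫ φ ∘ f dν`. -/
def imageVariance (φ : C(X, ℝ)) (μ : Measure (X ≃ₜ X)) (ν : Measure X) : ℝ :=
  ∫ f : X ≃ₜ X, (∫ x, φ (f x) ∂ν - ∫ x, φ x ∂mconv μ ν) ^ 2 ∂μ

lemma aestronglyMeasurable_integral_comp (μ : Measure (X ≃ₜ X)) (ν : Measure X)
    [IsProbabilityMeasure ν] (φ : C(X, ℝ)) :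
    AEStronglyMeasurable (fun f : X ≃ₜ X ↦ ∫ x, φ (f x) ∂ν) μ :=
  (StronglyMeasurable.integral_prod_right (f := fun (f : X ≃ₜ X) (x : X) ↦ φ (f x))
    (φ.continuous.comp continuous_homeo_eval).stronglyMeasurable).aestronglyMeasurable

lemma memLp_integral_comp (μ : Measure (X ≃ₜ X)) [IsProbabilityMeasure μ] (ν : Measure X)
    [IsProbabilityMeasure ν] (φ : C(X, ℝ)) (p : ℝ≥0∞) :
    MemLp (fun f : X ≃ₜ X ↦ ∫ x, φ (f x) ∂ν) p μ :=
  .of_bound (aestronglyMeasurable_integral_comp μ ν φ) ‖φ‖ (ae_of_all _ fun f ↦ by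
    simpa using norm_integral_le_of_norm_le_const (μ := ν)
      (ae_of_all _ fun x ↦ φ.norm_coe_le_norm (f x)))

lemma integrable_sq_integral_comp_sub (μ : Measure (X ≃ₜ X)) [IsProbabilityMeasure μ]
    (ν : Measure X) [IsProbabilityMeasure ν] (φ : C(X, ℝ)) (c : ℝ) :
    Integrable (fun f : X ≃ₜ X ↦ (∫ x, φ (f x) ∂ν - c) ^ 2) μ :=
  ((memLp_integral_comp μ ν φ 2).sub (memLp_const c)).integrable_sq

lemma imageVariance_eq (φ : C(X, ℝ)) (μ : Measure (X ≃ₜ X)) [IsProbabilityMeasure μ]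
    (ν : Measure X) [IsProbabilityMeasure ν] :
    imageVariance φ μ ν =
      (∫ p : (X ≃ₜ X) × X × X, φ (p.1 p.2.1) * φ (p.1 p.2.2) ∂(μ.prod (ν.prod ν))) -
        (∫ p : (X ≃ₜ X) × X, φ (p.1 p.2) ∂(μ.prod ν)) ^ 2 := by
  have hvar := ProbabilityTheory.variance_eq_sub (memLp_integral_comp μ ν φ 2)
  rw [ProbabilityTheory.variance_eq_integral
    (aestronglyMeasurable_integral_comp μ ν φ).aemeasurable] at hvar
  rw [imageVariance, integral_mconv, hvar, integral_prod _ (integrable_comp_homeo_eval μ ν φ),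
    integral_prod]
  · simp_rw [integral_prod_mul (fun x ↦ φ _) (fun x ↦ φ _)]
    simp [pow_two]
  · have hc : Continuous fun p : (X ≃ₜ X) × X × X ↦ φ (p.1 p.2.1) * φ (p.1 p.2.2) :=
      (φ.continuous.comp (continuous_homeo_eval.comp (by fun_prop :
        Continuous fun p : (X ≃ₜ X) × X × X ↦ (p.1, p.2.1)))).mul
      (φ.continuous.comp (continuous_homeo_eval.comp (by fun_prop :
        Continuous fun p : (X ≃ₜ X) × X × X ↦ (p.1, p.2.2))))
    refine .of_bound hc.aestronglyMeasurable (‖φ‖ * ‖φ‖) (ae_of_all _ fun p ↦ ?_)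
    rw [norm_mul]
    gcongr <;> exact φ.norm_coe_le_norm _

lemma continuous_imageVariance (φ : C(X, ℝ)) :
    Continuous fun q : ProbabilityMeasure (X ≃ₜ X) × ProbabilityMeasure X ↦
      imageVariance φ (q.1 : Measure (X ≃ₜ X)) (q.2 : Measure X) := by
  simp_rw [imageVariance_eq]
  let e : BoundedContinuousFunction ((X ≃ₜ X) × X) ℝ :=
    (BoundedContinuousFunction.mkOfCompact φ).compContinuous ⟨_, continuous_homeo_eval⟩
  let e₁ : BoundedContinuousFunction ((X ≃ₜ X) × X × X) ℝ :=
    e.compContinuous ⟨fun p ↦ (p.1, p.2.1), by fun_prop⟩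
  let e₂ : BoundedContinuousFunction ((X ≃ₜ X) × X × X) ℝ :=
    e.compContinuous ⟨fun p ↦ (p.1, p.2.2), by fun_prop⟩
  have h₂ : Continuous fun q : ProbabilityMeasure (X ≃ₜ X) × ProbabilityMeasure X ↦
      q.1.prod q.2 := ProbabilityMeasure.continuous_prod
  have h₃ : Continuous fun q : ProbabilityMeasure (X ≃ₜ X) × ProbabilityMeasure X ↦
      q.1.prod (q.2.prod q.2) :=
    ProbabilityMeasure.continuous_prod.comp (continuous_fst.prodMk
      (ProbabilityMeasure.continuous_prod.comp (continuous_snd.prodMk continuous_snd)))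
  exact ((ProbabilityMeasure.continuous_integral_boundedContinuousFunction (e₁ * e₂)).comp h₃).sub
    (((ProbabilityMeasure.continuous_integral_boundedContinuousFunction e).comp h₂).pow 2)

lemma imageVariance_le_furstEnt (φ : C(X, ℝ)) (μ : Measure (X ≃ₜ X)) [IsProbabilityMeasure μ]
    (ν : Measure X) [IsProbabilityMeasure ν] :
    ENNReal.ofReal (imageVariance φ μ ν / (4 * (‖φ‖ + 1) ^ 2)) ≤ furstEnt μ ν := by
  rw [imageVariance, ← integral_div, ofReal_integral_eq_lintegral_ofReal
    ((integrable_sq_integral_comp_sub μ ν φ _).div_const _)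
    (ae_of_all _ fun f ↦ div_nonneg (sq_nonneg _) (by positivity))]
  refine lintegral_mono fun f ↦ ?_
  have := Measure.isProbabilityMeasure_map (μ := ν) f.continuous.measurable.aemeasurable
  have hle := ofReal_sq_integral_sub_le_relEnt (ν.map f) (mconv μ ν) φ.continuous.measurable
    (C := ‖φ‖ + 1) (by positivity)
    (fun x ↦ (φ.norm_coe_le_norm x).trans (by linarith))
  rwa [integral_map f.continuous.measurable.aemeasurable
    φ.continuous.aestronglyMeasurable] at hle

/-- If every continuous function has a deterministic integral against `f_*ν`, then `f_*ν` is
almost surely equal to `μ * ν`. -/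
lemma ae_map_eq_mconv_of_imageVariance_nonpos (μ : Measure (X ≃ₜ X)) [IsProbabilityMeasure μ]
    (ν : Measure X) [IsProbabilityMeasure ν] (hvar : ∀ φ : C(X, ℝ), imageVariance φ μ ν ≤ 0) :
    ∀ᵐ f : X ≃ₜ X ∂μ, ν.map f = mconv μ ν := by
  have hae (φ : C(X, ℝ)) : ∀ᵐ f : X ≃ₜ X ∂μ, ∫ x, φ (f x) ∂ν = ∫ x, φ x ∂mconv μ ν := by
    have hnonneg : 0 ≤ᵐ[μ] fun f : X ≃ₜ X ↦ (∫ x, φ (f x) ∂ν - ∫ x, φ x ∂mconv μ ν) ^ 2 :=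
      ae_of_all _ fun f ↦ sq_nonneg _
    have hzero := (integral_eq_zero_iff_of_nonneg_ae hnonneg
      (integrable_sq_integral_comp_sub μ ν φ _)).1
      (le_antisymm (hvar φ) (integral_nonneg_of_ae hnonneg))
    filter_upwards [hzero] with f hf
    exact sub_eq_zero.1 (pow_eq_zero_iff two_ne_zero |>.1 hf)
  have hdense : ∀ᵐ f : X ≃ₜ X ∂μ, ∀ n, ∫ x, denseSeq C(X, ℝ) n (f x) ∂ν =
      ∫ x, denseSeq C(X, ℝ) n x ∂mconv μ ν := ae_all_iff.2 fun n ↦ hae _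
  filter_upwards [hdense] with f hf
  have := Measure.isProbabilityMeasure_map (μ := ν) f.continuous.measurable.aemeasurable
  have hcont (γ : Measure X) [IsProbabilityMeasure γ] :
      Continuous fun φ : C(X, ℝ) ↦ ∫ x, φ x ∂γ := by
    refine LipschitzWith.continuous (K := 1) (LipschitzWith.of_dist_le_mul fun φ₁ φ₂ ↦ ?_)
    have hint (φ : C(X, ℝ)) : Integrable (fun x ↦ φ x) γ :=
      .of_bound φ.continuous.aestronglyMeasurable ‖φ‖ (ae_of_all _ φ.norm_coe_le_norm)
    rw [dist_eq_norm, dist_eq_norm, ← integral_sub (hint φ₁) (hint φ₂)]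
    simpa using norm_integral_le_of_norm_le_const (μ := γ)
      (ae_of_all _ (φ₁ - φ₂).norm_coe_le_norm)
  have heq := DenseRange.equalizer (denseRange_denseSeq C(X, ℝ)) (hcont (ν.map f))
    (hcont (mconv μ ν)) (by
      ext n
      simp only [Function.comp_apply]
      rw [integral_map f.continuous.measurable.aemeasurable
        (denseSeq C(X, ℝ) n).continuous.aestronglyMeasurable, hf n])
  exact ext_of_forall_integral_eq_of_IsFiniteMeasure fun φ ↦ congrFun heq φ.toContinuousMap

end Homeo

end FurstenbergEntropy

/-- **Uniform positivity of the Furstenberg entropy** (Corollary 2.6).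
If no `μ ∈ K` admits a probability measure with a deterministic image, then
`𝐡 = inf_{μ ∈ K} inf_ν Φ_μ(ν) > 0`. -/
theorem furstenberg_entropy_uniformly_positive
    (X : Type) [MetricSpace X] [CompactSpace X] [MeasurableSpace X] [BorelSpace X]
    (K : Set (ProbabilityMeasure (X ≃ₜ X))) (hK : IsCompact K)
    (h : ∀ μ ∈ K, ¬ ∃ ν ν' : ProbabilityMeasure X,
      ∀ᵐ (f : X ≃ₜ X) ∂(μ : Measure (X ≃ₜ X)), (ν : Measure X).map f = (ν' : Measure X)) :
    0 < ⨅ (μ : K) (ν : ProbabilityMeasure X),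
        furstEnt ((μ : ProbabilityMeasure (X ≃ₜ X)) : Measure (X ≃ₜ X)) (ν : Measure X) := by
  open FurstenbergEntropy Filter Topology in
  obtain ⟨c, hc, hle⟩ : ∃ c : ℝ≥0∞, 0 < c ∧
      ∀ q ∈ K ×ˢ (Set.univ : Set (ProbabilityMeasure X)),
        c ≤ furstEnt (q.1 : Measure (X ≃ₜ X)) (q.2 : Measure X) := by
    refine (hK.prod isCompact_univ).induction_on
      (p := fun S : Set (ProbabilityMeasure (X ≃ₜ X) × ProbabilityMeasure X) ↦
        ∃ c : ℝ≥0∞, 0 < c ∧ ∀ q ∈ S, c ≤ furstEnt (q.1 : Measure (X ≃ₜ X)) (q.2 : Measure X))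
      ⟨1, one_pos, by simp⟩ ?_ ?_ ?_
    · rintro s t hst ⟨c, hc, hle⟩
      exact ⟨c, hc, fun q hq ↦ hle q (hst hq)⟩
    · rintro s t ⟨c, hc, hle⟩ ⟨c', hc', hle'⟩
      refine ⟨min c c', lt_min hc hc', ?_⟩
      rintro q (hq | hq)
      · exact (min_le_left _ _).trans (hle q hq)
      · exact (min_le_right _ _).trans (hle' q hq)
    · rintro ⟨μ, ν⟩ ⟨hμ, -⟩
      obtain ⟨φ, hφ⟩ : ∃ φ : C(X, ℝ), 0 < imageVariance φ (μ : Measure (X ≃ₜ X)) ν := by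
        by_contra! hvar
        exact h μ hμ ⟨ν, ⟨mconv (μ : Measure (X ≃ₜ X)) ν, inferInstance⟩,
          ae_map_eq_mconv_of_imageVariance_nonpos (μ : Measure (X ≃ₜ X)) ν hvar⟩
      set v := imageVariance φ (μ : Measure (X ≃ₜ X)) ν with hv
      refine ⟨_, mem_nhdsWithin_of_mem_nhds
        ((continuous_imageVariance φ).continuousAt.eventually
          (lt_mem_nhds (half_lt_self hφ))),
        ENNReal.ofReal (v / 2 / (4 * (‖φ‖ + 1) ^ 2)), ENNReal.ofReal_pos.2 (by positivity),
        fun q hq ↦ le_trans (ENNReal.ofReal_le_ofReal ?_)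
          (imageVariance_le_furstEnt φ (q.1 : Measure (X ≃ₜ X)) q.2)⟩
      have hq' : v / 2 < imageVariance φ (q.1 : Measure (X ≃ₜ X)) q.2 := hq
      gcongr
  exact hc.trans_le (le_iInf fun μ ↦ le_iInf fun ν ↦ hle (μ, ν) ⟨μ.2, trivial⟩)
end
end

section
/- Non-stationary additivity of the Furstenberg entropy. Let ν be a Borel probability measure on X and let μ, μ' be Borel probability measures on Homeo(X). Then Φ_{μ'*μ}(ν) = Φ_μ(ν) + Φ_{μ'}(ν'), where ν' = μ*ν and μ'*μ denotes the law of the composition f ∘ g with f ∼ μ' and g ∼ μ chosen independently. -/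
open MeasureTheory
open scoped ENNReal

noncomputable section

open ProbabilityTheory InformationTheory

section KullbackLeibler

variable {α β : Type*} {mα : MeasurableSpace α} {mβ : MeasurableSpace β}

lemma relEnt_eq_klDiv (ρ m : Measure α) [IsProbabilityMeasure ρ] [IsProbabilityMeasure m] :
    relEnt ρ m = klDiv ρ m := by
  rw [relEnt, klDiv_def]
  simp only [llr_def, probReal_univ, add_sub_cancel_right]
  congr

lemma klDiv_map_measurableEquiv (e : α ≃ᵐ β) (ρ m : Measure α)
    [IsFiniteMeasure ρ] [IsFiniteMeasure m] :
    klDiv (ρ.map e) (m.map e) = klDiv ρ m := by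
  refine le_antisymm (klDiv_map_le ρ m e.measurable) ?_
  have h := klDiv_map_le (ρ.map e) (m.map e) e.symm.measurable
  simpa [Measure.map_map e.symm.measurable e.measurable] using h

lemma klDiv_kernel_eq [MeasurableSpace.CountableOrCountablyGenerated α β]
    (κ η : Kernel α β) [IsFiniteKernel κ] [IsFiniteKernel η] (a : α) (h : κ a ≪ η a) :
    klDiv (κ a) (η a) = ∫⁻ x, ENNReal.ofReal (klFun (κ.rnDeriv η a x).toReal) ∂(η a) := by
  rw [klDiv_eq_lintegral_klFun_of_ac h]
  refine lintegral_congr_ae ?_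
  filter_upwards [Kernel.rnDeriv_eq_rnDeriv_measure (κ := κ) (η := η) (a := a)] with x hx
  rw [hx]

lemma measurable_klDiv_kernel [MeasurableSpace.CountableOrCountablyGenerated α β]
    (κ η : Kernel α β) [IsFiniteKernel κ] [IsFiniteKernel η] :
    Measurable fun a => klDiv (κ a) (η a) := by
  classical
  have h : (fun a => klDiv (κ a) (η a)) = fun a => if κ a ≪ η a then
      ∫⁻ x, ENNReal.ofReal (klFun (κ.rnDeriv η a x).toReal) ∂(η a) else ⊤ := by
    ext a
    split_ifs with h
    · exact klDiv_kernel_eq κ η a h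
    · exact klDiv_of_not_ac h
  rw [h]
  refine Measurable.ite (Kernel.measurableSet_absolutelyContinuous κ η) ?_ measurable_const
  refine Measurable.lintegral_kernel_prod_right' (κ := η)
    (f := fun p => ENNReal.ofReal (klFun (κ.rnDeriv η p.1 p.2).toReal)) ?_
  exact (measurable_klFun.comp (Kernel.measurable_rnDeriv κ η).ennreal_toReal).ennreal_ofReal

/-- The conditional Kullback–Leibler divergence, in integral form. -/
lemma klDiv_compProd_eq_lintegral [MeasurableSpace.CountableOrCountablyGenerated α β]
    (P : Measure α) [IsFiniteMeasure P]
    (κ η : Kernel α β) [IsFiniteKernel κ] [IsFiniteKernel η] :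
    klDiv (P ⊗ₘ κ) (P ⊗ₘ η) = ∫⁻ a, klDiv (κ a) (η a) ∂P := by
  have hmeas : Measurable fun p : α × β => κ.rnDeriv η p.1 p.2 := Kernel.measurable_rnDeriv κ η
  by_cases hac : P ⊗ₘ κ ≪ P ⊗ₘ η
  · have hae : ∀ᵐ a ∂P, κ a ≪ η a := Measure.absolutelyContinuous_compProd_right_iff.mp hac
    have hdens : P ⊗ₘ κ = (P ⊗ₘ η).withDensity fun p => κ.rnDeriv η p.1 p.2 := by
      refine Measure.ext fun s hs => ?_
      rw [Measure.compProd_apply hs, withDensity_apply _ hs, ← lintegral_indicator hs,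
        Measure.lintegral_compProd (hmeas.indicator hs)]
      refine lintegral_congr_ae ?_
      filter_upwards [hae] with a ha
      have hs' : MeasurableSet (Prod.mk a ⁻¹' s) := measurable_prodMk_left hs
      rw [← Measure.setLIntegral_rnDeriv ha, ← lintegral_indicator hs']
      refine lintegral_congr_ae ?_
      filter_upwards [Kernel.rnDeriv_eq_rnDeriv_measure (κ := κ) (η := η) (a := a)] with x hx
      by_cases hxs : (a, x) ∈ s
      · rw [Set.indicator_of_mem hxs, Set.indicator_of_mem (by exact hxs), hx]
      · rw [Set.indicator_of_notMem hxs, Set.indicator_of_notMem (by exact hxs)]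
    have hrn : (P ⊗ₘ κ).rnDeriv (P ⊗ₘ η) =ᵐ[P ⊗ₘ η] fun p => κ.rnDeriv η p.1 p.2 := by
      conv_lhs => rw [hdens]
      exact Measure.rnDeriv_withDensity _ hmeas
    have hkl : Measurable fun p : α × β =>
        ENNReal.ofReal (klFun (κ.rnDeriv η p.1 p.2).toReal) :=
      (measurable_klFun.comp hmeas.ennreal_toReal).ennreal_ofReal
    calc klDiv (P ⊗ₘ κ) (P ⊗ₘ η)
        = ∫⁻ p, ENNReal.ofReal (klFun (κ.rnDeriv η p.1 p.2).toReal) ∂(P ⊗ₘ η) := by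
          rw [klDiv_eq_lintegral_klFun_of_ac hac]
          refine lintegral_congr_ae ?_
          filter_upwards [hrn] with p hp
          rw [hp]
      _ = ∫⁻ a, klDiv (κ a) (η a) ∂P := by
          rw [Measure.lintegral_compProd hkl]
          refine lintegral_congr_ae ?_
          filter_upwards [hae] with a ha
          rw [klDiv_kernel_eq κ η a ha]
  · rw [klDiv_of_not_ac hac]
    symm
    by_contra hfin
    refine hac (Measure.absolutelyContinuous_compProd_right_iff.mpr ?_)
    filter_upwards [ae_lt_top (measurable_klDiv_kernel κ η) hfin] with a ha
    by_contra hna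
    exact ha.ne (klDiv_of_not_ac hna)

/-- The compensation identity: the mean divergence of a random measure from `m` is its mean
divergence from its barycenter, plus the divergence of the barycenter from `m`. -/
lemma lintegral_klDiv_const_eq_add [StandardBorelSpace α] [Nonempty α]
    [MeasurableSpace.CountablyGenerated β]
    (P : Measure α) [IsProbabilityMeasure P] (κ : Kernel α β) [IsMarkovKernel κ]
    (m : Measure β) [IsProbabilityMeasure m] :
    ∫⁻ a, klDiv (κ a) m ∂P =
      ∫⁻ a, klDiv (κ a) (P.bind κ) ∂P + klDiv (P.bind κ) m := by
  have hbary : IsProbabilityMeasure (P.bind κ) := inferInstance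
  have hswap (q : Measure β) [IsProbabilityMeasure q] :
      ∫⁻ a, klDiv (κ a) q ∂P = klDiv ((P ⊗ₘ κ).map Prod.swap) (q.prod P) := by
    have h1 := klDiv_compProd_eq_lintegral P κ (Kernel.const α q)
    simp only [Kernel.const_apply, Measure.compProd_const] at h1
    rw [← h1, ← Measure.prod_swap (μ := P) (ν := q)]
    exact (klDiv_map_measurableEquiv MeasurableEquiv.prodComm (P ⊗ₘ κ) (P.prod q)).symm
  set ρ := (P ⊗ₘ κ).map Prod.swap with hρ
  have : IsProbabilityMeasure ρ := Measure.isProbabilityMeasure_map measurable_swap.aemeasurable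
  have hfst : ρ.fst = P.bind κ := by
    rw [hρ, Measure.fst_map_swap, Measure.snd_compProd]
  have hdis : ρ = P.bind κ ⊗ₘ ρ.condKernel := by
    rw [← hfst]; exact (ρ.disintegrate ρ.condKernel).symm
  rw [hswap m, hswap (P.bind κ), hdis, ← Measure.compProd_const, ← Measure.compProd_const,
    klDiv_compProd_eq_add, add_comm]

end KullbackLeibler

section Homeomorph

lemma continuous_homeo_toContinuousMap {X : Type*} [TopologicalSpace X] :
    Continuous fun f : X ≃ₜ X => (f : C(X, X)) :=
  continuous_induced_dom

lemma klDiv_map_trans {X : Type*} [TopologicalSpace X] [MeasurableSpace X] [BorelSpace X]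
    (ν M : Measure X) [IsFiniteMeasure ν] [IsFiniteMeasure M] (f g : X ≃ₜ X) :
    klDiv (ν.map (g.trans f)) M = klDiv (ν.map g) (M.map f.symm) := by
  have h := klDiv_map_measurableEquiv f.symm.toMeasurableEquiv (ν.map (g.trans f)) M
  rw [← h, Measure.map_map f.symm.toMeasurableEquiv.measurable (g.trans f).measurable]
  congr 2
  ext x
  simp

variable {X : Type*} [MetricSpace X] [CompactSpace X]

instance homeo_secondCountableTopology : SecondCountableTopology (X ≃ₜ X) :=
  TopologicalSpace.secondCountableTopology_induced _ _ _

lemma measurable_homeo_comp : Measurable fun p : (X ≃ₜ X) × (X ≃ₜ X) => p.2.trans p.1 := by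
  refine Continuous.measurable (continuous_induced_rng.mpr ?_)
  exact (continuous_homeo_toContinuousMap.comp continuous_fst).compCM
    (continuous_homeo_toContinuousMap.comp continuous_snd)

lemma lintegral_hconv (μ' μ : Measure (X ≃ₜ X)) [SFinite μ] {F : (X ≃ₜ X) → ℝ≥0∞}
    (hF : Measurable F) :
    ∫⁻ h, F h ∂(hconv μ' μ) = ∫⁻ f, ∫⁻ g : X ≃ₜ X, F (g.trans f) ∂μ ∂μ' := by
  rw [hconv, lintegral_map hF measurable_homeo_comp]
  exact lintegral_prod _ (hF.comp measurable_homeo_comp).aemeasurable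

variable [MeasurableSpace X] [BorelSpace X]

/-- The kernel sending a parameter `ω` to the image of `ν` under `φ ω`. -/
def imageKernel {Ω : Type*} [MeasurableSpace Ω] (ν : Measure X) [SFinite ν]
    (φ : Ω → X → X) (hφ : Measurable (Function.uncurry φ)) : Kernel Ω X where
  toFun ω := ν.map (φ ω)
  measurable' := by
    refine Measure.measurable_of_measurable_coe _ fun s hs => ?_
    have h (ω : Ω) : ν.map (φ ω) s = ν (Prod.mk ω ⁻¹' (Function.uncurry φ ⁻¹' s)) :=
      Measure.map_apply hφ.of_uncurry_left hs
    simp_rw [h]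
    exact measurable_measure_prodMk_left (hφ hs)

instance isMarkovKernel_imageKernel {Ω : Type*} [MeasurableSpace Ω] (ν : Measure X)
    [IsProbabilityMeasure ν] (φ : Ω → X → X) (hφ : Measurable (Function.uncurry φ)) :
    IsMarkovKernel (imageKernel ν φ hφ) :=
  ⟨fun ω => Measure.isProbabilityMeasure_map (hφ.of_uncurry_left (x := ω)).aemeasurable⟩

lemma measurable_uncurry_homeo :
    Measurable (Function.uncurry fun (f : X ≃ₜ X) (x : X) => f x) :=
  ((continuous_homeo_toContinuousMap.comp continuous_fst).eval continuous_snd).measurable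

/-- The kernel `f ↦ f_* ν` on the group of homeomorphisms. -/
def homeoKernel (ν : Measure X) [SFinite ν] : Kernel (X ≃ₜ X) X :=
  imageKernel ν (fun f x => f x) measurable_uncurry_homeo

instance isMarkovKernel_homeoKernel (ν : Measure X) [IsProbabilityMeasure ν] :
    IsMarkovKernel (homeoKernel ν) :=
  inferInstanceAs (IsMarkovKernel (imageKernel ν _ measurable_uncurry_homeo))

lemma mconv_eq_bind (μ : Measure (X ≃ₜ X)) (ν : Measure X) [SFinite ν] :
    mconv μ ν = μ.bind (homeoKernel ν) := rfl

instance isProbabilityMeasure_mconv (μ : Measure (X ≃ₜ X)) [IsProbabilityMeasure μ]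
    (ν : Measure X) [IsProbabilityMeasure ν] : IsProbabilityMeasure (mconv μ ν) := by
  rw [mconv_eq_bind]
  infer_instance

lemma mconv_apply (μ : Measure (X ≃ₜ X)) (ν : Measure X) [SFinite ν] {s : Set X}
    (hs : MeasurableSet s) : mconv μ ν s = ∫⁻ f, ν (f ⁻¹' s) ∂μ := by
  rw [mconv_eq_bind, Measure.bind_apply hs (homeoKernel ν).aemeasurable]
  exact lintegral_congr fun f => Measure.map_apply f.measurable hs

lemma mconv_hconv (μ' μ : Measure (X ≃ₜ X)) [IsProbabilityMeasure μ'] [IsProbabilityMeasure μ]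
    (ν : Measure X) [IsProbabilityMeasure ν] :
    mconv (hconv μ' μ) ν = mconv μ' (mconv μ ν) := by
  ext s hs
  have hmeas : Measurable fun f : X ≃ₜ X => ν (f ⁻¹' s) := by
    have h := (homeoKernel ν).measurable_coe hs
    exact (funext fun f : X ≃ₜ X => Measure.map_apply f.measurable hs) ▸ h
  rw [mconv_apply _ _ hs, mconv_apply _ _ hs, lintegral_hconv μ' μ hmeas]
  refine lintegral_congr fun f => ?_
  rw [mconv_apply _ _ (f.measurable hs)]
  rfl

lemma lintegral_klDiv_homeo_eq_add (μ : Measure (X ≃ₜ X)) [IsProbabilityMeasure μ]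
    (ν m : Measure X) [IsProbabilityMeasure ν] [IsProbabilityMeasure m] :
    ∫⁻ g, klDiv (ν.map g) m ∂μ =
      ∫⁻ g, klDiv (ν.map g) (mconv μ ν) ∂μ + klDiv (mconv μ ν) m := by
  let : MeasurableSpace C(X, X) := borel _
  have : BorelSpace C(X, X) := ⟨rfl⟩
  have : Nonempty C(X, X) := ⟨ContinuousMap.id X⟩
  have hι : Measurable fun f : X ≃ₜ X => (f : C(X, X)) :=
    continuous_homeo_toContinuousMap.measurable
  have hφ : Measurable (Function.uncurry fun (f : C(X, X)) (x : X) => f x) :=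
    (continuous_fst.eval continuous_snd).measurable
  set κ := imageKernel ν (fun (f : C(X, X)) (x : X) => f x) hφ
  have hκ (g : X ≃ₜ X) : κ (g : C(X, X)) = ν.map g := rfl
  set P := μ.map fun f : X ≃ₜ X => (f : C(X, X))
  have : IsProbabilityMeasure P := Measure.isProbabilityMeasure_map hι.aemeasurable
  have hbind : P.bind κ = mconv μ ν := by
    rw [Measure.bind, Measure.map_map κ.measurable hι]
    rfl
  have hint (q : Measure X) [IsProbabilityMeasure q] :
      ∫⁻ g, klDiv (ν.map g) q ∂μ = ∫⁻ a, klDiv (κ a) q ∂P :=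
    (lintegral_map (measurable_klDiv_kernel κ (Kernel.const _ q)) hι).symm
  rw [hint m, hint (mconv μ ν), ← hbind]
  exact lintegral_klDiv_const_eq_add P κ m

lemma furstEnt_eq_lintegral_klDiv (μ : Measure (X ≃ₜ X)) [IsProbabilityMeasure μ]
    (ν : Measure X) [IsProbabilityMeasure ν] :
    furstEnt μ ν = ∫⁻ f, klDiv (ν.map f) (mconv μ ν) ∂μ := by
  refine lintegral_congr fun f => ?_
  have := Measure.isProbabilityMeasure_map (μ := ν) f.measurable.aemeasurable
  exact relEnt_eq_klDiv _ _

end Homeomorph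

/-- **Non-stationary additivity of the Furstenberg entropy** (Proposition 2.9).
`Φ_{μ'*μ}(ν) = Φ_μ(ν) + Φ_{μ'}(ν')` where `ν' = μ*ν`. -/
theorem furstenberg_entropy_additivity
    (X : Type) [MetricSpace X] [CompactSpace X] [MeasurableSpace X] [BorelSpace X]
    (μ μ' : ProbabilityMeasure (X ≃ₜ X)) (ν : ProbabilityMeasure X) :
    furstEnt (hconv (μ' : Measure (X ≃ₜ X)) (μ : Measure (X ≃ₜ X))) (ν : Measure X) =
      furstEnt (μ : Measure (X ≃ₜ X)) (ν : Measure X) +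
        furstEnt (μ' : Measure (X ≃ₜ X))
          (mconv (μ : Measure (X ≃ₜ X)) (ν : Measure X)) := by
  have hprob : IsProbabilityMeasure (hconv (μ' : Measure (X ≃ₜ X)) (μ : Measure (X ≃ₜ X))) :=
    Measure.isProbabilityMeasure_map measurable_homeo_comp.aemeasurable
  rw [furstEnt_eq_lintegral_klDiv, furstEnt_eq_lintegral_klDiv, furstEnt_eq_lintegral_klDiv,
    mconv_hconv]
  set ν' := mconv (μ : Measure (X ≃ₜ X)) (ν : Measure X)
  set M := mconv (μ' : Measure (X ≃ₜ X)) ν'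
  have hmeas : Measurable fun f : X ≃ₜ X => klDiv ((ν : Measure X).map f) M :=
    measurable_klDiv_kernel (homeoKernel (ν : Measure X)) (Kernel.const _ M)
  have hslice (f : X ≃ₜ X) :
      ∫⁻ g : X ≃ₜ X, klDiv ((ν : Measure X).map (g.trans f)) M ∂(μ : Measure (X ≃ₜ X)) =
        ∫⁻ g, klDiv ((ν : Measure X).map g) ν' ∂(μ : Measure (X ≃ₜ X)) +
          klDiv (ν'.map f) M := by
    have := Measure.isProbabilityMeasure_map (μ := M) f.symm.measurable.aemeasurable
    simp_rw [klDiv_map_trans]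
    rw [lintegral_klDiv_homeo_eq_add]
    congr 1
    have h := klDiv_map_trans ν' M f (Homeomorph.refl X)
    rw [show ⇑(Homeomorph.refl X) = id from rfl, Measure.map_id] at h
    exact h.symm
  rw [lintegral_hconv _ _ hmeas]
  simp_rw [hslice]
  rw [lintegral_add_left measurable_const, lintegral_const, measure_univ, mul_one]
end
end
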